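/- arXiv:1405.2544 — 3 statements merged into one kernel-verified Lean document; each statement's English description precedes it below -/
import Mathlib

section
/- (Interior decay of solutions in the weak-L² norm.) For every c₀ > 0 and every δ ∈ (0,1) there exists θ ∈ (0,1), depending only on c₀ and δ, such that: for every smooth function λ on the closed unit disc D̄² ⊂ ℝ² with λ(x) ≥ c₀ for all x, and every smooth v : D̄² → ℝ satisfying ∂_{x₁}((1 − e^{−2λ}) ∂_{x₁}v) + ∂_{x₂}((1 + e^{−2λ}) ∂_{x₂}v) = 0 in the open disc D², one has ‖v‖_{L^{2,∞}(B_θ(0))} ≤ δ ‖v‖_{L^{2,∞}(D²)}. -/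
noncomputable section

open Real MeasureTheory Metric
open scoped ENNReal

/-- The plane `ℝ²`. -/
abbrev RR2 := ℝ × ℝ

/-- Partial derivative in the `x₁` direction of a scalar map on `ℝ²`. -/
def d1s (f : RR2 → ℝ) (x : RR2) : ℝ := fderiv ℝ f x (1, 0)
/-- Partial derivative in the `x₂` direction of a scalar map on `ℝ²`. -/
def d2s (f : RR2 → ℝ) (x : RR2) : ℝ := fderiv ℝ f x (0, 1)

/-- The weak-`L²` (Marcinkiewicz) quasinorm `sup_{s>0} s · |{|v| > s}|^{1/2}` on `Ω`. -/
def weakL2 (Ω : Set RR2) (v : RR2 → ℝ) : ℝ≥0∞ :=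
  ⨆ s ∈ Set.Ioi (0 : ℝ),
    ENNReal.ofReal s * (volume {x | x ∈ Ω ∧ s < |v x|}) ^ (1 / 2 : ℝ)


open Set

structure Sol (κ : ℝ) (a b v : RR2 → ℝ) (v' F' G' : RR2 → RR2 →L[ℝ] ℝ) : Prop where
  kpos : 0 < κ
  ha : ∀ x ∈ ball (0 : RR2) 1, κ ≤ a x ∧ a x ≤ 2
  hb : ∀ x ∈ ball (0 : RR2) 1, κ ≤ b x ∧ b x ≤ 2
  ca : ContinuousOn a (ball (0 : RR2) 1)
  cb : ContinuousOn b (ball (0 : RR2) 1)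
  dv : ∀ x ∈ ball (0 : RR2) 1, HasFDerivAt v (v' x) x
  cv : ContinuousOn v' (ball (0 : RR2) 1)
  dF : ∀ x ∈ ball (0 : RR2) 1, HasFDerivAt (fun y => a y * v' y (1, 0)) (F' x) x
  cF : ContinuousOn F' (ball (0 : RR2) 1)
  dG : ∀ x ∈ ball (0 : RR2) 1, HasFDerivAt (fun y => b y * v' y (0, 1)) (G' x) x
  cG : ContinuousOn G' (ball (0 : RR2) 1)
  eq : ∀ x ∈ ball (0 : RR2) 1, F' x (1, 0) + G' x (0, 1) = 0

lemma Sol.smul {κ : ℝ} {a b v : RR2 → ℝ} {v' F' G' : RR2 → RR2 →L[ℝ] ℝ}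
    (h : Sol κ a b v v' F' G') (c : ℝ) :
    Sol κ a b (fun x => c * v x) (fun x => c • v' x) (fun x => c • F' x) (fun x => c • G' x) where
  kpos := h.kpos
  ha := h.ha
  hb := h.hb
  ca := h.ca
  cb := h.cb
  dv x hx := (h.dv x hx).const_mul c
  cv := h.cv.const_smul c
  dF x hx := by
    have e : (fun y => a y * (c • v' y) (1, 0)) = fun y => c * (a y * v' y (1, 0)) := by
      funext y; simp; ring
    rw [e]
    exact (h.dF x hx).const_mul c
  cF := h.cF.const_smul c
  dG x hx := by
    have e : (fun y => b y * (c • v' y) (0, 1)) = fun y => c * (b y * v' y (0, 1)) := by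
      funext y; simp; ring
    rw [e]
    exact (h.dG x hx).const_mul c
  cG := h.cG.const_smul c
  eq x hx := by
    have := h.eq x hx
    simp only [_root_.smul_apply, smul_eq_mul]
    rw [← mul_add, this, mul_zero]

lemma Sol.cont {κ : ℝ} {a b v : RR2 → ℝ} {v' F' G' : RR2 → RR2 →L[ℝ] ℝ}
    (h : Sol κ a b v v' F' G') : ContinuousOn v (ball (0 : RR2) 1) :=
  fun x hx => (h.dv x hx).continuousAt.continuousWithinAt

lemma Sol.cp {κ : ℝ} {a b v : RR2 → ℝ} {v' F' G' : RR2 → RR2 →L[ℝ] ℝ}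
    (h : Sol κ a b v v' F' G') (e : RR2) : ContinuousOn (fun x => v' x e) (ball (0 : RR2) 1) :=
  h.cv.clm_apply continuousOn_const

/-- integration by parts -/
lemma Sol.ibp {κ : ℝ} {a b v : RR2 → ℝ} {v' F' G' : RR2 → RR2 →L[ℝ] ℝ}
    (h : Sol κ a b v v' F' G') (x0 x1 y0 y1 : ℝ) (hx : x0 ≤ x1) (hy : y0 ≤ y1)
    (hsub : Icc x0 x1 ×ˢ Icc y0 y1 ⊆ ball (0 : RR2) 1)
    (ψ : RR2 → ℝ) (ψ' : RR2 → RR2 →L[ℝ] ℝ)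
    (dψ : ∀ x ∈ ball (0 : RR2) 1, HasFDerivAt ψ (ψ' x) x)
    (cψ : ContinuousOn ψ' (ball (0 : RR2) 1))
    (l0 : ∀ y ∈ Icc y0 y1, ψ (x0, y) = 0) (l1 : ∀ y ∈ Icc y0 y1, ψ (x1, y) = 0)
    (b0 : ∀ x ∈ Icc x0 x1, ψ (x, y0) = 0) (b1 : ∀ x ∈ Icc x0 x1, ψ (x, y1) = 0) :
    ∫ x in Icc x0 x1 ×ˢ Icc y0 y1,
      (ψ' x (1, 0) * (a x * v' x (1, 0)) + ψ' x (0, 1) * (b x * v' x (0, 1))) = 0 := by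
  have cψ0 : ContinuousOn ψ (ball (0 : RR2) 1) :=
    fun x hx => (dψ x hx).continuousAt.continuousWithinAt
  have hcompact : IsCompact (Icc x0 x1 ×ˢ Icc y0 y1) := isCompact_Icc.prod isCompact_Icc
  have cF0 : ContinuousOn (fun y => a y * v' y (1, 0)) (ball (0 : RR2) 1) := h.ca.mul (h.cp _)
  have cG0 : ContinuousOn (fun y => b y * v' y (0, 1)) (ball (0 : RR2) 1) := h.cb.mul (h.cp _)
  have eqI : (Icc ((x0, y0) : RR2) (x1, y1)) = Icc x0 x1 ×ˢ Icc y0 y1 := by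
    rw [Icc_prod_Icc]
  have sub2 : Ioo x0 x1 ×ˢ Ioo y0 y1 ⊆ ball (0 : RR2) 1 :=
    (Set.prod_mono Ioo_subset_Icc_self Ioo_subset_Icc_self).trans hsub
  have key := integral_divergence_prod_Icc_of_hasFDerivAt_of_le
    (fun y => ψ y * (a y * v' y (1, 0))) (fun y => ψ y * (b y * v' y (0, 1)))
    (fun y => ψ y • F' y + (a y * v' y (1, 0)) • ψ' y)
    (fun y => ψ y • G' y + (b y * v' y (0, 1)) • ψ' y)
    (x0, y0) (x1, y1) ⟨hx, hy⟩
    (by rw [eqI]; exact (cψ0.mul cF0).mono hsub)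
    (by rw [eqI]; exact (cψ0.mul cG0).mono hsub)
    (fun x hx => (dψ x (sub2 hx)).mul (h.dF x (sub2 hx)))
    (fun x hx => (dψ x (sub2 hx)).mul (h.dG x (sub2 hx)))
    (by
      rw [eqI]
      refine ContinuousOn.integrableOn_compact hcompact (ContinuousOn.mono ?_ hsub)
      exact (((cψ0.smul h.cF).add (cF0.smul cψ)).clm_apply continuousOn_const).add
        (((cψ0.smul h.cG).add (cG0.smul cψ)).clm_apply continuousOn_const))
  rw [eqI] at key
  have z1 : ∫ x in x0..x1, ψ (x, y1) * (b (x, y1) * v' (x, y1) (0, 1)) = 0 := by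
    rw [intervalIntegral.integral_congr (g := fun _ => 0)]
    · simp
    · intro x hx'
      rw [uIcc_of_le hx] at hx'
      simp [b1 x hx']
  have z2 : ∫ x in x0..x1, ψ (x, y0) * (b (x, y0) * v' (x, y0) (0, 1)) = 0 := by
    rw [intervalIntegral.integral_congr (g := fun _ => 0)]
    · simp
    · intro x hx'
      rw [uIcc_of_le hx] at hx'
      simp [b0 x hx']
  have z3 : ∫ y in y0..y1, ψ (x1, y) * (a (x1, y) * v' (x1, y) (1, 0)) = 0 := by
    rw [intervalIntegral.integral_congr (g := fun _ => 0)]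
    · simp
    · intro x hx'
      rw [uIcc_of_le hy] at hx'
      simp [l1 x hx']
  have z4 : ∫ y in y0..y1, ψ (x0, y) * (a (x0, y) * v' (x0, y) (1, 0)) = 0 := by
    rw [intervalIntegral.integral_congr (g := fun _ => 0)]
    · simp
    · intro x hx'
      rw [uIcc_of_le hy] at hx'
      simp [l0 x hx']
  simp only [z1, z2, z3, z4] at key
  simp only [sub_self, add_zero] at key
  refine Eq.trans ?_ key
  refine setIntegral_congr_fun hcompact.measurableSet ?_
  intro x hx
  have := h.eq x (hsub hx)
  simp only [_root_.add_apply, _root_.smul_apply, smul_eq_mul]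
  linear_combination (- ψ x) * this

lemma hasDerivAt_maxsq (M t : ℝ) :
    HasDerivAt (fun t => (max (t - M) 0) ^ 2) (2 * max (t - M) 0) t := by
  rcases lt_trichotomy t M with h | h | h
  · have : (fun _ => (0 : ℝ)) =ᶠ[nhds t] fun t => (max (t - M) 0) ^ 2 := by
      filter_upwards [Iio_mem_nhds h] with s hs
      have : s < M := hs
      rw [max_eq_right (by linarith)]; simp
    rw [max_eq_right (by linarith)]
    simpa using (hasDerivAt_const t (0 : ℝ)).congr_of_eventuallyEq this.symm
  · subst h
    simp only [sub_self, max_self, mul_zero]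
    rw [hasDerivAt_iff_isLittleO_nhds_zero]
    simp only [add_sub_cancel_left, sub_self, max_self, smul_zero]
    rw [Asymptotics.isLittleO_iff]
    intro c hc
    filter_upwards [Metric.ball_mem_nhds (0 : ℝ) hc] with x hx
    rw [mem_ball_zero_iff] at hx
    simp only [Real.norm_eq_abs] at *
    have h1 : |max x 0| ≤ |x| := by
      rcases le_total x 0 with h | h
      · rw [max_eq_right h]; simp
      · rw [max_eq_left h]
    have : |max x 0 ^ 2| ≤ |x| ^ 2 := by
      rw [abs_pow]; gcongr
    have e0 : max x 0 ^ 2 - 0 ^ 2 = max x 0 ^ 2 := by ring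
    rw [e0, sub_zero]
    nlinarith [abs_nonneg x]
  · have : (fun s => (s - M) ^ 2) =ᶠ[nhds t] fun t => (max (t - M) 0) ^ 2 := by
      filter_upwards [Ioi_mem_nhds h] with s hs
      have : M < s := hs
      rw [max_eq_left (by linarith)]
    rw [max_eq_left (by linarith)]
    have h2 := ((hasDerivAt_id t).sub_const M).pow 2
    refine (HasDerivAt.congr_of_eventuallyEq ?_ this.symm)
    refine HasDerivAt.congr_deriv h2 ?_
    norm_num

/-- maximum principle -/
lemma Sol.maxp {κ : ℝ} {a b v : RR2 → ℝ} {v' F' G' : RR2 → RR2 →L[ℝ] ℝ}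
    (h : Sol κ a b v v' F' G') (x0 x1 y0 y1 M : ℝ) (hx : x0 < x1) (hy : y0 < y1)
    (hsub : Icc x0 x1 ×ˢ Icc y0 y1 ⊆ ball (0 : RR2) 1)
    (l0 : ∀ y ∈ Icc y0 y1, v (x0, y) ≤ M) (l1 : ∀ y ∈ Icc y0 y1, v (x1, y) ≤ M)
    (b0 : ∀ x ∈ Icc x0 x1, v (x, y0) ≤ M) (b1 : ∀ x ∈ Icc x0 x1, v (x, y1) ≤ M) :
    ∀ x ∈ Icc x0 x1, ∀ y ∈ Icc y0 y1, v (x, y) ≤ M := by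
  have hcompact : IsCompact (Icc x0 x1 ×ˢ Icc y0 y1) := isCompact_Icc.prod isCompact_Icc
  have cm : ContinuousOn (fun x => 2 * max (v x - M) 0) (ball (0 : RR2) 1) :=
    continuousOn_const.mul ((h.cont.sub continuousOn_const).sup continuousOn_const)
  have dψ : ∀ x ∈ ball (0 : RR2) 1, HasFDerivAt (fun x => (max (v x - M) 0) ^ 2)
      ((2 * max (v x - M) 0) • v' x) x :=
    fun x hx => (hasDerivAt_maxsq M (v x)).comp_hasFDerivAt x (h.dv x hx)
  have key := h.ibp x0 x1 y0 y1 hx.le hy.le hsub (fun x => (max (v x - M) 0) ^ 2)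
    (fun x => (2 * max (v x - M) 0) • v' x) dψ
    (cm.smul h.cv)
    (fun y hy => by simp [l0 y hy]) (fun y hy => by simp [l1 y hy])
    (fun y hy => by simp [b0 y hy]) (fun y hy => by simp [b1 y hy])
  simp only [_root_.smul_apply, smul_eq_mul] at key
  have cI : ContinuousOn (fun x => 2 * max (v x - M) 0 * v' x (1, 0) * (a x * v' x (1, 0)) +
      2 * max (v x - M) 0 * v' x (0, 1) * (b x * v' x (0, 1))) (Icc x0 x1 ×ˢ Icc y0 y1) :=
    (((cm.mul (h.cp _)).mul (h.ca.mul (h.cp _))).add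
      ((cm.mul (h.cp _)).mul (h.cb.mul (h.cp _)))).mono hsub
  have t1 : ∀ x ∈ Icc x0 x1 ×ˢ Icc y0 y1, 0 ≤ 2 * max (v x - M) 0 * v' x (1, 0) * (a x * v' x (1, 0)) := by
    intro x hx
    have := (h.ha x (hsub hx)).1
    have k := h.kpos
    have h3 : 0 ≤ max (v x - M) 0 := le_max_right _ _
    have : 0 ≤ a x := by linarith
    have e : 2 * max (v x - M) 0 * v' x (1, 0) * (a x * v' x (1, 0))
      = 2 * max (v x - M) 0 * a x * (v' x (1, 0)) ^ 2 := by ring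
    rw [e]; positivity
  have t2 : ∀ x ∈ Icc x0 x1 ×ˢ Icc y0 y1, 0 ≤ 2 * max (v x - M) 0 * v' x (0, 1) * (b x * v' x (0, 1)) := by
    intro x hx
    have := (h.hb x (hsub hx)).1
    have k := h.kpos
    have h3 : 0 ≤ max (v x - M) 0 := le_max_right _ _
    have : 0 ≤ b x := by linarith
    have e : 2 * max (v x - M) 0 * v' x (0, 1) * (b x * v' x (0, 1))
      = 2 * max (v x - M) 0 * b x * (v' x (0, 1)) ^ 2 := by ring
    rw [e]; positivity
  rw [setIntegral_eq_zero_iff_of_nonneg_ae _ (cI.integrableOn_compact hcompact)] at key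
  swap
  · filter_upwards [ae_restrict_mem hcompact.measurableSet] with x hx
    exact add_nonneg (t1 x hx) (t2 x hx)
  have key2 := Measure.eqOn_of_ae_eq key cI continuousOn_const (by
    rw [interior_prod_eq, closure_prod_eq, interior_Icc, interior_Icc, closure_Ioo hx.ne,
      closure_Ioo hy.ne])
  have hz : ∀ x ∈ Icc x0 x1 ×ˢ Icc y0 y1, 2 * max (v x - M) 0 * v' x (1, 0) = 0 := by
    intro x hx
    have e1 := key2 hx
    simp only [Pi.zero_apply] at e1
    have e2 : 2 * max (v x - M) 0 * v' x (1, 0) * (a x * v' x (1, 0)) = 0 := by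
      linarith [t1 x hx, t2 x hx]
    have : a x ≠ 0 := by linarith [(h.ha x (hsub hx)).1, h.kpos]
    rcases mul_eq_zero.1 e2 with e3 | e3
    · exact e3
    · rcases mul_eq_zero.1 e3 with e4 | e4
      · exact absurd e4 this
      · rw [e4, mul_zero]
  intro x hx' y hy'
  have hd : ∀ s ∈ Icc x0 x1, HasDerivAt (fun s => (max (v (s, y) - M) 0) ^ 2) 0 s := by
    intro s hs
    have m : (s, y) ∈ Icc x0 x1 ×ˢ Icc y0 y1 := ⟨hs, hy'⟩
    have := (dψ (s, y) (hsub m)).comp_hasDerivAt s ((hasDerivAt_id s).prodMk (hasDerivAt_const s y))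
    simpa [Function.comp_def, hz (s, y) m] using this
  have hconst := constant_of_derivWithin_zero
    (fun s hs => (hd s hs).differentiableAt.differentiableWithinAt)
    (fun s hs => (hd s (Ico_subset_Icc_self hs)).hasDerivWithinAt.derivWithin
      ((uniqueDiffOn_Icc hx) s (Ico_subset_Icc_self hs))) x hx'
  have e0 : max (v (x0, y) - M) 0 = 0 := max_eq_right (by linarith [l0 y hy'])
  simp only [e0] at hconst
  have h5 : max (v (x, y) - M) 0 = 0 := by simpa using hconst
  have := le_max_left (v (x, y) - M) 0
  linarith

lemma line_bound (f g : ℝ → ℝ) (c d K : ℝ) (hcd : c < d)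
    (hd : ∀ y ∈ Icc c d, HasDerivAt f (g y) y) (cg : ContinuousOn g (Icc c d))
    (hK : ∫ y in Icc c d, (|f y| + |g y|) ≤ K) :
    ∀ y ∈ Icc c d, |f y| ≤ ((d - c)⁻¹ + 1) * K := by
  have cf : ContinuousOn f (Icc c d) := fun y hy => (hd y hy).continuousAt.continuousWithinAt
  have i1 : IntegrableOn (fun y => |f y|) (Icc c d) := cf.abs.integrableOn_compact isCompact_Icc
  have i2 : IntegrableOn (fun y => |g y|) (Icc c d) := cg.abs.integrableOn_compact isCompact_Icc
  have hvol : (volume (Icc c d)).toReal = d - c := by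
    rw [Real.volume_Icc, ENNReal.toReal_ofReal (by linarith)]
  obtain ⟨y0, hy0, hle⟩ := exists_le_setAverage (μ := volume) (s := Icc c d) (f := fun y => |f y|)
    (by rw [Real.volume_Icc]; simp [hcd]) (by rw [Real.volume_Icc]; simp) i1
  rw [setAverage_eq, measureReal_def, hvol, smul_eq_mul] at hle
  rw [integral_add i1 i2] at hK
  have n1 : 0 ≤ ∫ y in Icc c d, |f y| := integral_nonneg (fun _ => abs_nonneg _)
  have n2 : 0 ≤ ∫ y in Icc c d, |g y| := integral_nonneg (fun _ => abs_nonneg _)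
  intro y hy
  have sub : uIcc y0 y ⊆ Icc c d := uIcc_subset_Icc hy0 hy
  have ftc := intervalIntegral.integral_eq_sub_of_hasDerivAt (fun x hx => hd x (sub hx))
    ((cg.mono sub).intervalIntegrable)
  have h1 : |f y - f y0| ≤ ∫ y in Icc c d, |g y| := by
    rw [← ftc]
    have := intervalIntegral.norm_integral_le_integral_norm_uIoc (f := g) (a := y0) (b := y)
      (μ := volume)
    simp only [Real.norm_eq_abs] at this
    refine this.trans ?_
    exact setIntegral_mono_set i2 (Filter.Eventually.of_forall fun _ => abs_nonneg _)
      (Filter.Eventually.of_forall (uIoc_subset_uIcc.trans sub))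
  have hpos : 0 < (d - c)⁻¹ := inv_pos.2 (by linarith)
  have h2 : |f y| ≤ |f y0| + |f y - f y0| := by
    have := abs_add_le (f y0) (f y - f y0)
    simpa using this
  have h3 : (d - c)⁻¹ * ∫ y in Icc c d, |f y| ≤ (d - c)⁻¹ * K :=
    mul_le_mul_of_nonneg_left (by linarith) hpos.le
  linarith

lemma good_line (f g : RR2 → ℝ) (α β c d C : ℝ) (hαβ : α < β) (hcd : c < d)
    (cf : ContinuousOn f (Icc α β ×ˢ Icc c d)) (cg : ContinuousOn g (Icc α β ×ˢ Icc c d))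
    (hd : ∀ x ∈ Icc α β, ∀ y ∈ Icc c d, HasDerivAt (fun t => f (x, t)) (g (x, y)) y)
    (hC : ∫ p in Icc α β ×ˢ Icc c d, (|f p| + |g p|) ≤ C) :
    ∃ x ∈ Icc α β, ∀ y ∈ Icc c d, |f (x, y)| ≤ ((d - c)⁻¹ + 1) * ((β - α)⁻¹ * C) := by
  have hcompact : IsCompact (Icc α β ×ˢ Icc c d) := isCompact_Icc.prod isCompact_Icc
  have hi : IntegrableOn (fun p => |f p| + |g p|) (Icc α β ×ˢ Icc c d) :=
    (cf.abs.add cg.abs).integrableOn_compact hcompact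
  have hi' : Integrable (fun p : ℝ × ℝ => |f p| + |g p|)
      ((volume.restrict (Icc α β)).prod (volume.restrict (Icc c d))) := by
    rw [Measure.prod_restrict]; exact hi
  have hI := hi'.integral_prod_left
  have e : ∫ p in Icc α β ×ˢ Icc c d, (|f p| + |g p|)
      = ∫ x in Icc α β, ∫ y in Icc c d, (|f (x, y)| + |g (x, y)|) :=
    setIntegral_prod (μ := volume) (ν := volume) (fun p => |f p| + |g p|) hi
  rw [e] at hC
  obtain ⟨x, hx, hle⟩ := exists_le_setAverage (μ := volume) (s := Icc α β)
    (f := fun x => ∫ y in Icc c d, (|f (x, y)| + |g (x, y)|))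
    (by rw [Real.volume_Icc]; simp [hαβ]) (by rw [Real.volume_Icc]; simp) hI
  rw [setAverage_eq, measureReal_def, Real.volume_Icc, ENNReal.toReal_ofReal (by linarith),
    smul_eq_mul] at hle
  have hpos : 0 < (β - α)⁻¹ := inv_pos.2 (by linarith)
  refine ⟨x, hx, line_bound (fun y => f (x, y)) (fun y => g (x, y)) c d _ hcd (hd x hx) ?_
    (hle.trans (mul_le_mul_of_nonneg_left hC hpos.le))⟩
  exact cg.comp (by fun_prop) (fun y hy => ⟨hx, hy⟩)

lemma weak_bound (f : RR2 → ℝ) (μ : Measure RR2) (hm : AEMeasurable f μ)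
    (hμ : μ univ ≤ 4) (hf : ∀ s : ℝ, 0 < s → μ {x | s < |f x|} ≤ ENNReal.ofReal (1 / s ^ 2)) :
    ∫⁻ x, ENNReal.ofReal (|f x| ^ (3 / 2 : ℝ)) ∂μ ≤ 9 := by
  rw [lintegral_rpow_eq_lintegral_meas_lt_mul μ (f := fun x => |f x|)
    (Filter.Eventually.of_forall fun _ => abs_nonneg _)
    (by simpa [Real.norm_eq_abs] using hm.norm) (by norm_num)]
  have hsplit : Ioi (0 : ℝ) = Ioc 0 1 ∪ Ioi 1 := by
    rw [Ioc_union_Ioi_eq_Ioi]; norm_num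
  have A : ∫⁻ t in Ioc (0 : ℝ) 1, μ {a | t < |f a|} * ENNReal.ofReal (t ^ ((3 / 2 : ℝ) - 1)) ≤ 4 := by
    calc _ ≤ ∫⁻ t in Ioc (0 : ℝ) 1, 4 := by
          refine setLIntegral_mono measurable_const ?_
          intro t ht
          calc _ ≤ (4 : ℝ≥0∞) * 1 := by
                gcongr
                · exact (measure_mono (subset_univ _)).trans hμ
                · rw [ENNReal.ofReal_le_one]
                  exact Real.rpow_le_one ht.1.le ht.2 (by norm_num)
            _ = 4 := by simp
      _ = 4 := by simp
  have B : ∫⁻ t in Ioi (1 : ℝ), μ {a | t < |f a|} * ENNReal.ofReal (t ^ ((3 / 2 : ℝ) - 1)) ≤ 2 := by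
    calc _ ≤ ∫⁻ t in Ioi (1 : ℝ), ENNReal.ofReal (t ^ (-(3 / 2) : ℝ)) := by
          refine setLIntegral_mono (by fun_prop) ?_
          intro t ht
          have h0 : (0 : ℝ) < t := lt_trans one_pos ht
          calc _ ≤ ENNReal.ofReal (1 / t ^ 2) * ENNReal.ofReal (t ^ ((3 / 2 : ℝ) - 1)) := by
                gcongr
                exact hf t h0
            _ = _ := by
                rw [← ENNReal.ofReal_mul (by positivity)]
                congr 1
                have : (1 : ℝ) / t ^ 2 = t ^ (-2 : ℝ) := by
                  rw [Real.rpow_neg h0.le]; norm_num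
                rw [this, ← Real.rpow_add h0]; norm_num
      _ = ENNReal.ofReal (∫ t in Ioi (1 : ℝ), t ^ (-(3 / 2) : ℝ)) := by
          rw [ofReal_integral_eq_lintegral_ofReal]
          · exact integrableOn_Ioi_rpow_of_lt (by norm_num) one_pos
          · filter_upwards [ae_restrict_mem measurableSet_Ioi] with t ht
            have h0 : (0 : ℝ) < t := lt_trans one_pos ht
            simp only [Pi.zero_apply]; positivity
      _ ≤ 2 := by
          rw [integral_Ioi_rpow_of_lt (by norm_num) one_pos]
          norm_num
  rw [hsplit]
  calc _ ≤ ENNReal.ofReal (3 / 2) * (4 + 2) := by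
        gcongr
        exact (lintegral_union_le _ _ _).trans (add_le_add A B)
    _ ≤ 9 := by
        have : (4 + 2 : ℝ≥0∞) = ENNReal.ofReal 6 := by norm_num
        rw [this, ← ENNReal.ofReal_mul (by norm_num)]; norm_num

lemma ptwise (v : ℝ) : arsinh v ^ 2 * √(1 + v ^ 2) ≤ 7 * (1 + |v| ^ (3 / 2 : ℝ)) := by
  set t := arsinh v with ht
  have hc : cosh t = √(1 + v ^ 2) := Real.cosh_arsinh v
  have h1 : |t| ^ 4 / 24 ≤ exp |t| := by
    have := Real.pow_div_factorial_le_exp |t| (abs_nonneg _) 4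
    simpa [Nat.factorial] using this
  have h2 : exp |t| / 2 ≤ cosh t := by
    rw [← Real.cosh_abs, Real.cosh_eq]
    have := (Real.exp_pos (-|t|)).le
    linarith
  have hs1 : 1 ≤ cosh t := Real.one_le_cosh t
  have h3 : (t ^ 2) ^ 2 ≤ 7 ^ 2 * (√(cosh t)) ^ 2 := by
    rw [Real.sq_sqrt (by linarith)]
    have : (t ^ 2) ^ 2 = |t| ^ 4 := by
      rw [← sq_abs t]; ring
    rw [this]; linarith
  have h4 : t ^ 2 ≤ 7 * √(cosh t) := by
    refine abs_le_of_sq_le_sq' (by linarith) (by positivity) |>.2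
  have h5 : √(cosh t) * cosh t ≤ 1 + |v| ^ (3 / 2 : ℝ) := by
    have e : √(cosh t) * cosh t = (1 + v ^ 2) ^ (3 / 4 : ℝ) := by
      rw [hc, Real.sqrt_eq_rpow, Real.sqrt_eq_rpow, ← Real.rpow_mul (by positivity),
        ← Real.rpow_add (by positivity)]
      norm_num
    rw [e]
    have := Real.rpow_add_le_add_rpow (a := 1) (b := v ^ 2) zero_le_one (sq_nonneg v)
      (p := 3 / 4) (by norm_num) (by norm_num)
    refine this.trans (le_of_eq ?_)
    rw [Real.one_rpow, ← sq_abs v, ← Real.rpow_natCast, ← Real.rpow_mul (abs_nonneg _)]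
    norm_num
  rw [← hc]
  calc t ^ 2 * cosh t ≤ 7 * √(cosh t) * cosh t := by gcongr
    _ = 7 * (√(cosh t) * cosh t) := by ring
    _ ≤ _ := by gcongr

def cut (x : RR2) : ℝ := (1 / 4 - x.1 ^ 2) * (1 / 4 - x.2 ^ 2)

def cut' (x : RR2) : RR2 →L[ℝ] ℝ :=
  (-(2 * x.1) * (1 / 4 - x.2 ^ 2)) • ContinuousLinearMap.fst ℝ ℝ ℝ +
    (-(2 * x.2) * (1 / 4 - x.1 ^ 2)) • ContinuousLinearMap.snd ℝ ℝ ℝ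

lemma cut_deriv (x : RR2) : HasFDerivAt cut (cut' x) x := by
  have h1 : HasFDerivAt (fun x : RR2 => x.1) (ContinuousLinearMap.fst ℝ ℝ ℝ) x := hasFDerivAt_fst
  have h2 : HasFDerivAt (fun x : RR2 => x.2) (ContinuousLinearMap.snd ℝ ℝ ℝ) x := hasFDerivAt_snd
  have := ((h1.pow 2).const_sub (1 / 4)).mul ((h2.pow 2).const_sub (1 / 4))
  refine this.congr_fderiv ?_
  ext <;> simp [cut'] <;> ring

lemma cut'_cont : Continuous cut' := by
  unfold cut'
  fun_prop

lemma cut_cont : Continuous cut := by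
  unfold cut
  fun_prop

lemma sq_sub_ball (r : ℝ) (hr : r < 1) : Icc (-r) r ×ˢ Icc (-r) r ⊆ ball (0 : RR2) 1 := by
  rintro ⟨x, y⟩ ⟨hx, hy⟩
  rw [mem_ball_zero_iff, Prod.norm_def]
  simp only [Real.norm_eq_abs, sup_lt_iff]
  exact ⟨(abs_le.2 hx).trans_lt hr, (abs_le.2 hy).trans_lt hr⟩

lemma alg_ineq (a κ p s z η η1 u : ℝ) (ha : κ ≤ a) (ha2 : a ≤ 2) (hκ : 0 < κ) (hz : 0 < z)
    (hsz : s * z = 1) (hs : 0 < s) (hη1 : |η1| ≤ 1 / 4) :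
    κ / 2 * (η ^ 2 * (p ^ 2 * z)) - u ^ 2 * s / 4 ≤
      (2 * η * u * η1 + η ^ 2 * z * p) * (a * p) := by
  have e1 : 0 ≤ a / 2 * (z * (η * p + 2 * u * s * η1) ^ 2) := by
    have : 0 < a := by linarith
    positivity
  have e2 : a / 2 * (z * (η * p + 2 * u * s * η1) ^ 2) =
      a / 2 * (η ^ 2 * (p ^ 2 * z)) + 2 * a * η * u * η1 * p + 2 * a * u ^ 2 * s * η1 ^ 2 := by
    linear_combination (2 * a * η * u * η1 * p + 2 * a * u ^ 2 * η1 ^ 2 * s) * hsz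
  have e3 : η1 ^ 2 ≤ 1 / 16 := by
    rw [← sq_abs]; nlinarith [abs_nonneg η1]
  have e4 : 2 * a * u ^ 2 * s * η1 ^ 2 ≤ u ^ 2 * s / 4 := by
    have : a * η1 ^ 2 ≤ 2 * (1 / 16) := by
      apply mul_le_mul ha2 e3 (sq_nonneg _) (by norm_num)
    have h0 : 0 ≤ u ^ 2 * s := by positivity
    nlinarith
  have e5 : κ / 2 * (η ^ 2 * (p ^ 2 * z)) ≤ a / 2 * (η ^ 2 * (p ^ 2 * z)) := by
    gcongr
  nlinarith

lemma Sol.energy {κ : ℝ} {a b v : RR2 → ℝ} {v' F' G' : RR2 → RR2 →L[ℝ] ℝ}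
    (h : Sol κ a b v v' F' G') (T : ℝ)
    (hT : ∫ x in Icc (-(1/2) : ℝ) (1/2) ×ˢ Icc (-(1/2) : ℝ) (1/2),
      arsinh (v x) ^ 2 * √(1 + v x ^ 2) ≤ T) :
    ∫ x in Icc (-(1/4) : ℝ) (1/4) ×ˢ Icc (-(1/4) : ℝ) (1/4),
      (2 + arsinh (v x) ^ 2 * √(1 + v x ^ 2) +
        (v' x (1, 0) ^ 2 * (√(1 + v x ^ 2))⁻¹ + v' x (0, 1) ^ 2 * (√(1 + v x ^ 2))⁻¹))
      ≤ 1 / 2 + T + 1000 * T / κ := by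
  set Q2 := Icc (-(1/2) : ℝ) (1/2) ×ˢ Icc (-(1/2) : ℝ) (1/2) with hQ2
  set Q4 := Icc (-(1/4) : ℝ) (1/4) ×ˢ Icc (-(1/4) : ℝ) (1/4) with hQ4
  have k2 : IsCompact Q2 := isCompact_Icc.prod isCompact_Icc
  have k4 : IsCompact Q4 := isCompact_Icc.prod isCompact_Icc
  have s2 : Q2 ⊆ ball (0 : RR2) 1 := sq_sub_ball _ (by norm_num)
  have s42 : Q4 ⊆ Q2 := Set.prod_mono (Icc_subset_Icc (by norm_num) (by norm_num))
    (Icc_subset_Icc (by norm_num) (by norm_num))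
  have spos : ∀ x, 0 < √(1 + v x ^ 2) := fun x => by positivity
  have cs : ContinuousOn (fun x => √(1 + v x ^ 2)) (ball (0 : RR2) 1) :=
    (continuousOn_const.add (h.cont.pow 2)).sqrt
  have cz : ContinuousOn (fun x => (√(1 + v x ^ 2))⁻¹) (ball (0 : RR2) 1) :=
    cs.inv₀ (fun x _ => (spos x).ne')
  have cu : ContinuousOn (fun x => arsinh (v x)) (ball (0 : RR2) 1) :=
    Real.continuous_arsinh.comp_continuousOn h.cont
  have cU : ContinuousOn (fun x => arsinh (v x) ^ 2 * √(1 + v x ^ 2)) (ball (0 : RR2) 1) :=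
    (cu.pow 2).mul cs
  have cE : ContinuousOn (fun x => v' x (1, 0) ^ 2 * (√(1 + v x ^ 2))⁻¹
      + v' x (0, 1) ^ 2 * (√(1 + v x ^ 2))⁻¹) (ball (0 : RR2) 1) :=
    (((h.cp _).pow 2).mul cz).add (((h.cp _).pow 2).mul cz)
  have cψ : ContinuousOn (fun x => (2 * cut x * arsinh (v x)) • cut' x +
      (cut x ^ 2 * (√(1 + v x ^ 2))⁻¹) • v' x) (ball (0 : RR2) 1) :=
    (((continuousOn_const.mul cut_cont.continuousOn).mul cu).smul cut'_cont.continuousOn).add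
      (((cut_cont.continuousOn.pow 2).mul cz).smul h.cv)
  have key := h.ibp (-(1/2)) (1/2) (-(1/2)) (1/2) (by norm_num) (by norm_num) s2
    (fun x => cut x ^ 2 * arsinh (v x))
    (fun x => (2 * cut x * arsinh (v x)) • cut' x +
      (cut x ^ 2 * (√(1 + v x ^ 2))⁻¹) • v' x)
    (fun x hx => by
      have := ((cut_deriv x).pow 2).mul ((h.dv x hx).arsinh)
      refine this.congr_fderiv ?_
      ext <;> simp <;> ring)
    cψ
    (fun y hy => by simp [cut]; norm_num) (fun y hy => by simp [cut]; norm_num)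
    (fun y hy => by simp [cut]; norm_num) (fun y hy => by simp [cut]; norm_num)
  rw [← hQ2] at key
  have cD : ContinuousOn (fun x => ((2 * cut x * arsinh (v x)) • cut' x +
      (cut x ^ 2 * (√(1 + v x ^ 2))⁻¹) • v' x) (1, 0) * (a x * v' x (1, 0)) +
      ((2 * cut x * arsinh (v x)) • cut' x +
      (cut x ^ 2 * (√(1 + v x ^ 2))⁻¹) • v' x) (0, 1) * (b x * v' x (0, 1)))
      (ball (0 : RR2) 1) :=
    ((cψ.clm_apply continuousOn_const).mul (h.ca.mul (h.cp _))).add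
      ((cψ.clm_apply continuousOn_const).mul (h.cb.mul (h.cp _)))
  have cηE : ContinuousOn (fun x => cut x ^ 2 * (v' x (1, 0) ^ 2 * (√(1 + v x ^ 2))⁻¹
      + v' x (0, 1) ^ 2 * (√(1 + v x ^ 2))⁻¹)) (ball (0 : RR2) 1) :=
    (cut_cont.continuousOn.pow 2).mul cE
  have iU := (cU.mono s2).integrableOn_compact (μ := volume) k2
  have iE := (cE.mono s2).integrableOn_compact (μ := volume) k2
  have iηE := (cηE.mono s2).integrableOn_compact (μ := volume) k2
  have iD := (cD.mono s2).integrableOn_compact (μ := volume) k2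
  have hκ := h.kpos
  -- energy estimate
  have en : κ / 2 * (∫ x in Q2, cut x ^ 2 * (v' x (1, 0) ^ 2 * (√(1 + v x ^ 2))⁻¹
      + v' x (0, 1) ^ 2 * (√(1 + v x ^ 2))⁻¹)) -
      (1 / 2) * (∫ x in Q2, arsinh (v x) ^ 2 * √(1 + v x ^ 2)) ≤ 0 := by
    refine le_trans ?_ key.le
    rw [← integral_const_mul, ← integral_const_mul,
      ← integral_sub (iηE.const_mul _) (iU.const_mul _)]
    refine setIntegral_mono_on ((iηE.const_mul _).sub (iU.const_mul _)) iD k2.measurableSet ?_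
    intro x hx
    obtain ⟨hx1, hx2⟩ := hx
    have hsz : √(1 + v x ^ 2) * (√(1 + v x ^ 2))⁻¹ = 1 := mul_inv_cancel₀ (spos x).ne'
    have hz : 0 < (√(1 + v x ^ 2))⁻¹ := inv_pos.2 (spos x)
    have q1 : x.1 ^ 2 ≤ 1 / 4 := by nlinarith [hx1.1, hx1.2]
    have q2 : x.2 ^ 2 ≤ 1 / 4 := by nlinarith [hx2.1, hx2.2]
    have g1 : |cut' x (1, 0)| ≤ 1 / 4 := by
      simp only [cut', _root_.add_apply, _root_.smul_apply, ContinuousLinearMap.coe_fst',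
        ContinuousLinearMap.coe_snd', smul_eq_mul, mul_one, mul_zero, add_zero]
      have : |x.1| ≤ 1 / 2 := abs_le.2 hx1
      rw [abs_mul, abs_neg, abs_mul, abs_of_nonneg (by linarith : 0 ≤ 1 / 4 - x.2 ^ 2), abs_two]
      nlinarith [abs_nonneg x.1, sq_nonneg x.2]
    have g2 : |cut' x (0, 1)| ≤ 1 / 4 := by
      simp only [cut', _root_.add_apply, _root_.smul_apply, ContinuousLinearMap.coe_fst',
        ContinuousLinearMap.coe_snd', smul_eq_mul, mul_one, mul_zero, zero_add]
      have : |x.2| ≤ 1 / 2 := abs_le.2 hx2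
      rw [abs_mul, abs_neg, abs_mul, abs_of_nonneg (by linarith : 0 ≤ 1 / 4 - x.1 ^ 2), abs_two]
      nlinarith [abs_nonneg x.2, sq_nonneg x.1]
    have A := alg_ineq (a x) κ (v' x (1, 0)) _ _ (cut x) (cut' x (1, 0)) (arsinh (v x))
      (h.ha x (s2 ⟨hx1, hx2⟩)).1 (h.ha x (s2 ⟨hx1, hx2⟩)).2 hκ hz hsz (spos x) g1
    have B := alg_ineq (b x) κ (v' x (0, 1)) _ _ (cut x) (cut' x (0, 1)) (arsinh (v x))
      (h.hb x (s2 ⟨hx1, hx2⟩)).1 (h.hb x (s2 ⟨hx1, hx2⟩)).2 hκ hz hsz (spos x) g2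
    simp only [_root_.add_apply, _root_.smul_apply, smul_eq_mul]
    linarith
  have en2 : (∫ x in Q2, cut x ^ 2 * (v' x (1, 0) ^ 2 * (√(1 + v x ^ 2))⁻¹
      + v' x (0, 1) ^ 2 * (√(1 + v x ^ 2))⁻¹)) ≤ T / κ := by
    rw [le_div_iff₀ hκ]; linarith
  have Enn : ∀ x, 0 ≤ v' x (1, 0) ^ 2 * (√(1 + v x ^ 2))⁻¹
      + v' x (0, 1) ^ 2 * (√(1 + v x ^ 2))⁻¹ := fun x => by positivity
  have e4 : ∫ x in Q4, (v' x (1, 0) ^ 2 * (√(1 + v x ^ 2))⁻¹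
      + v' x (0, 1) ^ 2 * (√(1 + v x ^ 2))⁻¹) ≤ 1000 * (T / κ) := by
    refine le_trans ?_ (mul_le_mul_of_nonneg_left en2 (by norm_num))
    rw [← integral_const_mul]
    refine le_trans (setIntegral_mono_on (iE.mono_set s42) ((iηE.mono_set s42).const_mul 1000)
      k4.measurableSet ?_) (setIntegral_mono_set (iηE.const_mul 1000) ?_ ?_)
    · intro x hx
      obtain ⟨hx1, hx2⟩ := hx
      have q1 : x.1 ^ 2 ≤ 1 / 16 := by nlinarith [hx1.1, hx1.2]
      have q2 : x.2 ^ 2 ≤ 1 / 16 := by nlinarith [hx2.1, hx2.2]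
      have c1 : (3 / 16) * (3 / 16) ≤ cut x :=
        mul_le_mul (by linarith) (by linarith) (by norm_num) (by linarith)
      have c2 : 1 ≤ 1000 * cut x ^ 2 := by nlinarith
      nlinarith [Enn x]
    · refine Filter.Eventually.of_forall fun x => ?_
      have := Enn x
      simp only [Pi.zero_apply]
      positivity
    · exact Filter.Eventually.of_forall s42
  have U4 : ∫ x in Q4, arsinh (v x) ^ 2 * √(1 + v x ^ 2) ≤ T :=
    (setIntegral_mono_set iU (Filter.Eventually.of_forall fun x => by
      simp only [Pi.zero_apply]; positivity) (Filter.Eventually.of_forall s42)).trans hT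
  have vol4 : volume.real Q4 = 1 / 4 := by
    rw [hQ4, measureReal_def, Measure.volume_eq_prod, Measure.prod_prod, Real.volume_Icc,
      ENNReal.toReal_mul, ENNReal.toReal_ofReal (by norm_num)]
    norm_num
  have ic : IntegrableOn (fun _ : RR2 => (2 : ℝ)) Q4 :=
    continuousOn_const.integrableOn_compact k4
  have i2U : IntegrableOn (fun x => 2 + arsinh (v x) ^ 2 * √(1 + v x ^ 2)) Q4 :=
    ic.add (iU.mono_set s42)
  rw [integral_add i2U (iE.mono_set s42), integral_add ic (iU.mono_set s42), setIntegral_const,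
    vol4, smul_eq_mul]
  have : 1000 * T / κ = 1000 * (T / κ) := by ring
  rw [this]
  linarith

lemma Sol.bound {κ : ℝ} {a b v : RR2 → ℝ} {v' F' G' : RR2 → RR2 →L[ℝ] ℝ}
    (h : Sol κ a b v v' F' G')
    (hw : ∀ s : ℝ, 0 < s → volume {x | x ∈ ball (0 : RR2) 1 ∧ s < |v x|} ≤
      ENNReal.ofReal (1 / s ^ 2)) :
    ∀ x ∈ ball (0 : RR2) (1 / 8), |v x| ≤ sinh (24 * (1 / 2 + 70 + 1000 * 70 / κ)) := by
  set Q2 := Icc (-(1/2) : ℝ) (1/2) ×ˢ Icc (-(1/2) : ℝ) (1/2) with hQ2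
  set Q4 := Icc (-(1/4) : ℝ) (1/4) ×ˢ Icc (-(1/4) : ℝ) (1/4) with hQ4
  have k2 : IsCompact Q2 := isCompact_Icc.prod isCompact_Icc
  have k4 : IsCompact Q4 := isCompact_Icc.prod isCompact_Icc
  have s2 : Q2 ⊆ ball (0 : RR2) 1 := sq_sub_ball _ (by norm_num)
  have s4 : Q4 ⊆ ball (0 : RR2) 1 := sq_sub_ball _ (by norm_num)
  have spos : ∀ x, 0 < √(1 + v x ^ 2) := fun x => by positivity
  have cs : ContinuousOn (fun x => √(1 + v x ^ 2)) (ball (0 : RR2) 1) :=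
    (continuousOn_const.add (h.cont.pow 2)).sqrt
  have cz : ContinuousOn (fun x => (√(1 + v x ^ 2))⁻¹) (ball (0 : RR2) 1) :=
    cs.inv₀ (fun x _ => (spos x).ne')
  have cu : ContinuousOn (fun x => arsinh (v x)) (ball (0 : RR2) 1) :=
    Real.continuous_arsinh.comp_continuousOn h.cont
  have cU : ContinuousOn (fun x => arsinh (v x) ^ 2 * √(1 + v x ^ 2)) (ball (0 : RR2) 1) :=
    (cu.pow 2).mul cs
  have vol2 : volume Q2 = 1 := by
    rw [hQ2, Measure.volume_eq_prod, Measure.prod_prod, Real.volume_Icc]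
    norm_num
  -- the weak bound
  have hT : ∫ x in Q2, arsinh (v x) ^ 2 * √(1 + v x ^ 2) ≤ 70 := by
    have hm : AEMeasurable v (volume.restrict Q2) :=
      (h.cont.mono s2).aemeasurable k2.measurableSet
    have hb := weak_bound v (volume.restrict Q2) hm
      (by rw [Measure.restrict_apply_univ, vol2]; norm_num)
      (fun s hs => by
        rw [Measure.restrict_apply' k2.measurableSet]
        refine le_trans (measure_mono ?_) (hw s hs)
        rintro x ⟨hx1, hx2⟩
        exact ⟨s2 hx2, hx1⟩)
    rw [← ENNReal.ofReal_le_ofReal_iff (by norm_num),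
      ofReal_integral_eq_lintegral_ofReal ((cU.mono s2).integrableOn_compact k2)
        (Filter.Eventually.of_forall fun x => by simp only [Pi.zero_apply]; positivity)]
    calc _ ≤ ∫⁻ x in Q2, ENNReal.ofReal 7 * (1 + ENNReal.ofReal (|v x| ^ (3 / 2 : ℝ))) := by
          refine lintegral_mono fun x => ?_
          refine (ENNReal.ofReal_le_ofReal (ptwise (v x))).trans (le_of_eq ?_)
          rw [ENNReal.ofReal_mul (by norm_num), ENNReal.ofReal_add (by norm_num) (by positivity)]
          simp
      _ = ENNReal.ofReal 7 * (1 + ∫⁻ x in Q2, ENNReal.ofReal (|v x| ^ (3 / 2 : ℝ))) := by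
          rw [lintegral_const_mul' _ _ (by simp), lintegral_add_left measurable_const]
          simp [vol2]
      _ ≤ ENNReal.ofReal 7 * (1 + 9) := by gcongr
      _ ≤ ENNReal.ofReal 70 := by
          have : (1 + 9 : ℝ≥0∞) = ENNReal.ofReal 10 := by norm_num
          rw [this, ← ENNReal.ofReal_mul (by norm_num)]; norm_num
  set C := 1 / 2 + 70 + 1000 * 70 / κ with hC
  have en := h.energy 70 hT
  rw [← hQ4, ← hC] at en
  have du : ∀ x ∈ ball (0 : RR2) 1, HasFDerivAt (fun x => arsinh (v x))
      ((√(1 + v x ^ 2))⁻¹ • v' x) x := fun x hx => (h.dv x hx).arsinh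
  have cu' : ∀ e, ContinuousOn (fun x => (√(1 + v x ^ 2))⁻¹ * v' x e) (ball (0 : RR2) 1) :=
    fun e => cz.mul (h.cp e)
  have cE : ContinuousOn (fun x => 2 + arsinh (v x) ^ 2 * √(1 + v x ^ 2) +
      (v' x (1, 0) ^ 2 * (√(1 + v x ^ 2))⁻¹
      + v' x (0, 1) ^ 2 * (√(1 + v x ^ 2))⁻¹)) (ball (0 : RR2) 1) :=
    (continuousOn_const.add cU).add ((((h.cp _).pow 2).mul cz).add (((h.cp _).pow 2).mul cz))
  have pt : ∀ x, ∀ p, (p = v' x (1, 0) ∨ p = v' x (0, 1)) →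
      |arsinh (v x)| + |(√(1 + v x ^ 2))⁻¹ * p| ≤ 2 + arsinh (v x) ^ 2 * √(1 + v x ^ 2) +
      (v' x (1, 0) ^ 2 * (√(1 + v x ^ 2))⁻¹ + v' x (0, 1) ^ 2 * (√(1 + v x ^ 2))⁻¹) := by
    intro x p hp
    have s1 : 1 ≤ √(1 + v x ^ 2) := by
      rw [Real.one_le_sqrt]; nlinarith [sq_nonneg (v x)]
    have z1 : (√(1 + v x ^ 2))⁻¹ ≤ 1 := inv_le_one_of_one_le₀ s1
    have z0 : 0 < (√(1 + v x ^ 2))⁻¹ := inv_pos.2 (spos x)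
    have hp2 : p ^ 2 * (√(1 + v x ^ 2))⁻¹ ≤ v' x (1, 0) ^ 2 * (√(1 + v x ^ 2))⁻¹
        + v' x (0, 1) ^ 2 * (√(1 + v x ^ 2))⁻¹ := by
      have e1 : 0 ≤ v' x (1, 0) ^ 2 * (√(1 + v x ^ 2))⁻¹ := by positivity
      have e2 : 0 ≤ v' x (0, 1) ^ 2 * (√(1 + v x ^ 2))⁻¹ := by positivity
      rcases hp with rfl | rfl <;> linarith
    generalize √(1 + v x ^ 2) = s at *
    generalize arsinh (v x) = u at *
    generalize s⁻¹ = z at *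
    have q1 : |u| ≤ 1 + u ^ 2 * s := by
      have : u ^ 2 ≤ u ^ 2 * s := by nlinarith [sq_nonneg u]
      nlinarith [sq_abs u, sq_nonneg (|u| - 1)]
    have q2 : |z * p| ≤ 1 + p ^ 2 * z := by
      have : (z * p) ^ 2 ≤ p ^ 2 * z := by
        have : 0 ≤ p ^ 2 * z := by positivity
        nlinarith
      nlinarith [sq_abs (z * p), sq_nonneg (|z * p| - 1)]
    linarith
  have iE := (cE.mono s4).integrableOn_compact (μ := volume) k4
  have strip : ∀ S : Set RR2, MeasurableSet S → S ⊆ Q4 → ∀ e : RR2, (e = (1, 0) ∨ e = (0, 1)) →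
      ∫ x in S, (|arsinh (v x)| + |(√(1 + v x ^ 2))⁻¹ * v' x e|) ≤ C := by
    intro S mS hS e he
    refine le_trans ?_ en
    have ii : IntegrableOn (fun x => |arsinh (v x)| + |(√(1 + v x ^ 2))⁻¹ * v' x e|) Q4 :=
      ((cu.abs.add (cu' e).abs).mono s4).integrableOn_compact k4
    refine le_trans (setIntegral_mono_on (ii.mono_set hS) (iE.mono_set hS) mS
      (fun x _ => pt x _ ?_)) (setIntegral_mono_set iE ?_ (Filter.Eventually.of_forall hS))
    · rcases he with rfl | rfl <;> simp
    · refine Filter.Eventually.of_forall fun x => ?_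
      simp only [Pi.zero_apply]; positivity
  have mono_v : ∀ x, |arsinh (v x)| ≤ 24 * C → |v x| ≤ sinh (24 * C) := by
    intro x hx
    have e : v x = sinh (arsinh (v x)) := (Real.sinh_arsinh _).symm
    rw [abs_le] at hx ⊢
    constructor
    · rw [← Real.sinh_neg, e]; exact Real.sinh_le_sinh.2 (by linarith)
    · rw [e]; simpa using Real.sinh_le_sinh.2 hx.2
  -- vertical lines
  have vert : ∀ α : ℝ, -(1/4) ≤ α → α + 1/8 ≤ 1/4 → ∃ x ∈ Icc α (α + 1/8),
      ∀ y ∈ Icc (-(1/4) : ℝ) (1/4), |v (x, y)| ≤ sinh (24 * C) := by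
    intro α h1 h2
    have sub : Icc α (α + 1/8) ×ˢ Icc (-(1/4) : ℝ) (1/4) ⊆ Q4 :=
      Set.prod_mono (Icc_subset_Icc h1 h2) le_rfl
    obtain ⟨x, hx, hb⟩ := good_line (fun x => arsinh (v x))
      (fun x => (√(1 + v x ^ 2))⁻¹ * v' x (0, 1)) α (α + 1/8) (-(1/4)) (1/4) C (by linarith)
      (by norm_num) (cu.mono (sub.trans s4)) ((cu' _).mono (sub.trans s4))
      (fun x hx y hy => by
        have := (du (x, y) (s4 (sub ⟨hx, hy⟩))).comp_hasDerivAt y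
          ((hasDerivAt_const y x).prodMk (hasDerivAt_id y))
        simpa [Function.comp_def] using this)
      (strip _ (measurableSet_Icc.prod measurableSet_Icc) sub _ (Or.inr rfl))
    refine ⟨x, hx, fun y hy => mono_v _ ((hb y hy).trans (le_of_eq ?_))⟩
    rw [add_sub_cancel_left]; norm_num; ring
  have horiz : ∀ α : ℝ, -(1/4) ≤ α → α + 1/8 ≤ 1/4 → ∃ y ∈ Icc α (α + 1/8),
      ∀ x ∈ Icc (-(1/4) : ℝ) (1/4), |v (x, y)| ≤ sinh (24 * C) := by
    intro α h1 h2
    have sub : Icc (-(1/4) : ℝ) (1/4) ×ˢ Icc α (α + 1/8) ⊆ Q4 :=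
      Set.prod_mono le_rfl (Icc_subset_Icc h1 h2)
    have msw : MapsTo Prod.swap (Icc α (α + 1/8) ×ˢ Icc (-(1/4) : ℝ) (1/4)) (ball (0 : RR2) 1) :=
      fun p hp => s4 (sub ⟨hp.2, hp.1⟩)
    obtain ⟨x, hx, hb⟩ := good_line (fun x => arsinh (v x.swap))
      (fun x => (√(1 + v x.swap ^ 2))⁻¹ * v' x.swap (1, 0)) α (α + 1/8) (-(1/4)) (1/4) C
      (by linarith)
      (by norm_num) (cu.comp continuous_swap.continuousOn msw)
      ((cu' _).comp continuous_swap.continuousOn msw)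
      (fun x hx y hy => by
        have := (du (y, x) (s4 (sub ⟨hy, hx⟩))).comp_hasDerivAt y
          ((hasDerivAt_id y).prodMk (hasDerivAt_const y x))
        simpa [Function.comp_def] using this)
      (by
        have e := setIntegral_prod_swap (μ := volume) (ν := volume) (Icc (-(1/4) : ℝ) (1/4))
          (Icc α (α + 1/8))
          (fun x : ℝ × ℝ => |arsinh (v x)| + |(√(1 + v x ^ 2))⁻¹ * v' x (1, 0)|)
        refine le_trans (le_of_eq e) ?_
        exact strip _ (measurableSet_Icc.prod measurableSet_Icc) sub _ (Or.inl rfl))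
    refine ⟨x, hx, fun y hy => mono_v _ ((hb y hy).trans (le_of_eq ?_))⟩
    rw [add_sub_cancel_left]; norm_num; ring
  obtain ⟨x0, hx0, bx0⟩ := vert (-(1/4)) (by norm_num) (by norm_num)
  obtain ⟨x1, hx1, bx1⟩ := vert (1/8) (by norm_num) (by norm_num)
  obtain ⟨y0, hy0, by0⟩ := horiz (-(1/4)) (by norm_num) (by norm_num)
  obtain ⟨y1, hy1, by1⟩ := horiz (1/8) (by norm_num) (by norm_num)
  simp only [mem_Icc] at hx0 hx1 hy0 hy1
  have subx : Icc x0 x1 ⊆ Icc (-(1/4) : ℝ) (1/4) := Icc_subset_Icc (by linarith) (by linarith)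
  have suby : Icc y0 y1 ⊆ Icc (-(1/4) : ℝ) (1/4) := Icc_subset_Icc (by linarith) (by linarith)
  have hR : Icc x0 x1 ×ˢ Icc y0 y1 ⊆ ball (0 : RR2) 1 := (Set.prod_mono subx suby).trans s4
  have up := h.maxp x0 x1 y0 y1 (sinh (24 * C)) (by linarith) (by linarith) hR
    (fun y hy => (abs_le.1 (bx0 y (suby hy))).2) (fun y hy => (abs_le.1 (bx1 y (suby hy))).2)
    (fun y hy => (abs_le.1 (by0 y (subx hy))).2) (fun y hy => (abs_le.1 (by1 y (subx hy))).2)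
  have dn := (h.smul (-1)).maxp x0 x1 y0 y1 (sinh (24 * C)) (by linarith) (by linarith) hR
    (fun y hy => by linarith [(abs_le.1 (bx0 y (suby hy))).1])
    (fun y hy => by linarith [(abs_le.1 (bx1 y (suby hy))).1])
    (fun y hy => by linarith [(abs_le.1 (by0 y (subx hy))).1])
    (fun y hy => by linarith [(abs_le.1 (by1 y (subx hy))).1])
  rintro ⟨x, y⟩ hxy
  rw [mem_ball_zero_iff, Prod.norm_def] at hxy
  simp only [Real.norm_eq_abs, sup_lt_iff, abs_lt] at hxy
  have mx : x ∈ Icc x0 x1 := ⟨by linarith, by linarith⟩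
  have my : y ∈ Icc y0 y1 := ⟨by linarith, by linarith⟩
  rw [abs_le]
  exact ⟨by linarith [dn x mx y my], up x mx y my⟩

lemma sol_of (c₀ : ℝ) (hc₀ : 0 < c₀) (lam v : RR2 → ℝ)
    (hl : ContDiffOn ℝ (⊤ : ℕ∞) lam (closedBall (0 : RR2) 1))
    (hlc : ∀ x ∈ closedBall (0 : RR2) 1, c₀ ≤ lam x)
    (hv : ContDiffOn ℝ (⊤ : ℕ∞) v (closedBall (0 : RR2) 1))
    (heq : ∀ x ∈ ball (0 : RR2) 1,
          d1s (fun y => (1 - exp (-(2 * lam y))) * d1s v y) x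
            + d2s (fun y => (1 + exp (-(2 * lam y))) * d2s v y) x = 0) :
    Sol (1 - exp (-(2 * c₀))) (fun y => 1 - exp (-(2 * lam y))) (fun y => 1 + exp (-(2 * lam y))) v
      (fderiv ℝ v) (fderiv ℝ (fun y => (1 - exp (-(2 * lam y))) * fderiv ℝ v y (1, 0)))
      (fderiv ℝ (fun y => (1 + exp (-(2 * lam y))) * fderiv ℝ v y (0, 1))) := by
  have nh : ∀ x ∈ ball (0 : RR2) 1, closedBall (0 : RR2) 1 ∈ nhds x := fun x hx =>
    Filter.mem_of_superset (isOpen_ball.mem_nhds hx) ball_subset_closedBall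
  have sl : ∀ x ∈ ball (0 : RR2) 1, ContDiffAt ℝ (⊤ : ℕ∞) lam x := fun x hx =>
    hl.contDiffAt (nh x hx)
  have sv : ∀ x ∈ ball (0 : RR2) 1, ContDiffAt ℝ (⊤ : ℕ∞) v x := fun x hx =>
    hv.contDiffAt (nh x hx)
  have sv' : ∀ x ∈ ball (0 : RR2) 1, ContDiffAt ℝ 1 (fderiv ℝ v) x := fun x hx =>
    ((sv x hx).of_le (m := 2) (WithTop.coe_le_coe.2 (le_top : (2 : ℕ∞) ≤ ⊤))).fderiv_right (by norm_num)
  have sa : ∀ x ∈ ball (0 : RR2) 1, ContDiffAt ℝ 1 (fun y => 1 - exp (-(2 * lam y))) x :=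
    fun x hx => contDiffAt_const.sub
      ((contDiffAt_const.mul ((sl x hx).of_le (by exact_mod_cast le_top))).neg.exp)
  have sb : ∀ x ∈ ball (0 : RR2) 1, ContDiffAt ℝ 1 (fun y => 1 + exp (-(2 * lam y))) x :=
    fun x hx => contDiffAt_const.add
      ((contDiffAt_const.mul ((sl x hx).of_le (by exact_mod_cast le_top))).neg.exp)
  have sF : ∀ x ∈ ball (0 : RR2) 1,
      ContDiffAt ℝ 1 (fun y => (1 - exp (-(2 * lam y))) * fderiv ℝ v y (1, 0)) x :=
    fun x hx => (sa x hx).mul ((sv' x hx).clm_apply contDiffAt_const)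
  have sG : ∀ x ∈ ball (0 : RR2) 1,
      ContDiffAt ℝ 1 (fun y => (1 + exp (-(2 * lam y))) * fderiv ℝ v y (0, 1)) x :=
    fun x hx => (sb x hx).mul ((sv' x hx).clm_apply contDiffAt_const)
  have hexp : ∀ x ∈ ball (0 : RR2) 1, exp (-(2 * lam x)) ≤ exp (-(2 * c₀)) := fun x hx =>
    Real.exp_le_exp.2 (by linarith [hlc x (ball_subset_closedBall hx)])
  have e1 : exp (-(2 * c₀)) < 1 := Real.exp_lt_one_iff.2 (by linarith)
  refine ⟨by linarith, ?_, ?_, ?_, ?_, ?_, ?_, ?_, ?_, ?_, ?_, ?_⟩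
  · intro x hx
    have := hexp x hx
    have := Real.exp_pos (-(2 * lam x))
    constructor <;> linarith
  · intro x hx
    have := hexp x hx
    have := Real.exp_pos (-(2 * lam x))
    have := Real.exp_pos (-(2 * c₀))
    constructor <;> linarith
  · exact fun x hx => (sa x hx).continuousAt.continuousWithinAt
  · exact fun x hx => (sb x hx).continuousAt.continuousWithinAt
  · exact fun x hx => ((sv x hx).differentiableAt (by simp)).hasFDerivAt
  · exact fun x hx => (sv' x hx).continuousAt.continuousWithinAt
  · exact fun x hx => ((sF x hx).differentiableAt (by simp)).hasFDerivAt
  · exact fun x hx => ((sF x hx).fderiv_right (m := 0) (by simp)).continuousAt.continuousWithinAt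
  · exact fun x hx => ((sG x hx).differentiableAt (by simp)).hasFDerivAt
  · exact fun x hx => ((sG x hx).fderiv_right (m := 0) (by simp)).continuousAt.continuousWithinAt
  · exact fun x hx => heq x hx

/-- **interior weak-`L²` decay.** For every `c₀ > 0` and `δ ∈ (0,1)` there is
`θ ∈ (0,1)`, depending only on `c₀` and `δ`, such that every smooth solution of
`∂_{x₁}((1-e^{-2λ})∂_{x₁}v) + ∂_{x₂}((1+e^{-2λ})∂_{x₂}v) = 0` in the unit disc with `λ ≥ c₀`
satisfies `‖v‖_{L^{2,∞}(B_θ)} ≤ δ ‖v‖_{L^{2,∞}(D²)}`. -/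
theorem interior_weakL2_decay (c₀ δ : ℝ) (hc₀ : 0 < c₀) (hδ0 : 0 < δ) (hδ1 : δ < 1) :
    ∃ θ : ℝ, 0 < θ ∧ θ < 1 ∧
      ∀ lam v : RR2 → ℝ,
        ContDiffOn ℝ (⊤ : ℕ∞) lam (closedBall (0 : RR2) 1) →
        (∀ x ∈ closedBall (0 : RR2) 1, c₀ ≤ lam x) →
        ContDiffOn ℝ (⊤ : ℕ∞) v (closedBall (0 : RR2) 1) →
        (∀ x ∈ ball (0 : RR2) 1,
          d1s (fun y => (1 - exp (-(2 * lam y))) * d1s v y) x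
            + d2s (fun y => (1 + exp (-(2 * lam y))) * d2s v y) x = 0) →
        weakL2 (ball (0 : RR2) θ) v ≤ ENNReal.ofReal δ * weakL2 (ball (0 : RR2) 1) v := by
  set κ := 1 - exp (-(2 * c₀)) with hκ
  have hκ0 : 0 < κ := by
    have : exp (-(2 * c₀)) < 1 := Real.exp_lt_one_iff.2 (by linarith)
    linarith
  set M := sinh (24 * (1 / 2 + 70 + 1000 * 70 / κ)) with hM
  have hM0 : 0 < M := Real.sinh_pos_iff.2 (by positivity)
  refine ⟨min (1 / 8) (δ / (2 * M)), by positivity,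
    lt_of_le_of_lt (min_le_left _ _) (by norm_num), ?_⟩
  set θ := min (1 / 8) (δ / (2 * M)) with hθ
  have hθ0 : 0 < θ := by positivity
  have hθ1 : θ ≤ 1 / 8 := min_le_left _ _
  have hθ2 : 2 * θ * M ≤ δ := by
    have : θ ≤ δ / (2 * M) := min_le_right _ _
    rw [le_div_iff₀ (by positivity)] at this
    linarith
  intro lam v hl hlc hv heq
  have sol := sol_of c₀ hc₀ lam v hl hlc hv heq
  rw [← hκ] at sol
  set W := weakL2 (ball (0 : RR2) 1) v with hW
  have hWs : ∀ s : ℝ, 0 < s →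
      ENNReal.ofReal s * (volume {x | x ∈ ball (0 : RR2) 1 ∧ s < |v x|}) ^ (1 / 2 : ℝ) ≤ W := by
    intro s hs
    exact le_iSup₂_of_le (f := fun s (_ : s ∈ Set.Ioi (0 : ℝ)) =>
      ENNReal.ofReal s * (volume {x | x ∈ ball (0 : RR2) 1 ∧ s < |v x|}) ^ (1 / 2 : ℝ)) s hs le_rfl
  by_cases htop : W = ⊤
  · rw [htop, ENNReal.mul_top (by simpa using hδ0)]
    exact le_top
  by_cases hzero : W = 0
  · rw [hzero, mul_zero, ← hzero]
    refine iSup₂_mono fun s hs => ?_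
    gcongr
    linarith
  set w := W.toReal with hw
  have hw0 : 0 < w := ENNReal.toReal_pos hzero htop
  have hWw : W = ENNReal.ofReal w := (ENNReal.ofReal_toReal htop).symm
  have hbound : ∀ x ∈ ball (0 : RR2) (1 / 8), |v x| ≤ M * w := by
    have := (sol.smul w⁻¹).bound (by
      intro s hs
      have h1 := hWs (s * w) (by positivity)
      have e : {x | x ∈ ball (0 : RR2) 1 ∧ s < |w⁻¹ * v x|}
          = {x | x ∈ ball (0 : RR2) 1 ∧ s * w < |v x|} := by
        ext x
        simp only [mem_ofPred_eq, abs_mul, abs_inv, abs_of_pos hw0]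
        rw [inv_mul_eq_div, lt_div_iff₀ hw0]
      rw [e]
      set m := volume {x | x ∈ ball (0 : RR2) 1 ∧ s * w < |v x|}
      have h2 : m ^ (1 / 2 : ℝ) ≤ ENNReal.ofReal (1 / s) := by
        have : ENNReal.ofReal (1 / s) = ENNReal.ofReal w / ENNReal.ofReal (s * w) := by
          rw [← ENNReal.ofReal_div_of_pos (by positivity)]
          congr 1; field_simp
        rw [this, ENNReal.le_div_iff_mul_le (Or.inl (by simp; positivity)) (Or.inl (by simp)),
          mul_comm, ← hWw]
        exact h1
      calc m = (m ^ (1 / 2 : ℝ)) ^ (2 : ℝ) := by rw [← ENNReal.rpow_mul]; norm_num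
        _ ≤ (ENNReal.ofReal (1 / s)) ^ (2 : ℝ) := by gcongr
        _ = ENNReal.ofReal (1 / s ^ 2) := by
          rw [ENNReal.ofReal_rpow_of_pos (by positivity)]
          congr 1; norm_num)
    intro x hx
    have h3 := this x hx
    rw [abs_mul, abs_inv, abs_of_pos hw0, inv_mul_eq_div, div_le_iff₀ hw0] at h3
    exact h3
  refine iSup₂_le fun s hs => ?_
  have hs0 : 0 < s := hs
  by_cases hsM : M * w ≤ s
  · have : {x | x ∈ ball (0 : RR2) θ ∧ s < |v x|} = ∅ := by
      rw [Set.eq_empty_iff_forall_notMem]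
      rintro x ⟨hx1, hx2⟩
      linarith [hbound x (ball_subset_ball hθ1 hx1)]
    rw [this]; simp
  · push Not at hsM
    have hvol : volume {x | x ∈ ball (0 : RR2) θ ∧ s < |v x|} ≤ ENNReal.ofReal ((2 * θ) ^ 2) := by
      refine (measure_mono (fun x hx => hx.1)).trans (b := volume (ball (0 : RR2) θ)) (le_of_eq ?_)
      have : (0 : RR2) = ((0 : ℝ), (0 : ℝ)) := rfl
      rw [this, ← ball_prod_same, Measure.volume_eq_prod, Measure.prod_prod, Real.volume_ball,
        ← ENNReal.ofReal_mul (by positivity), sq]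
    calc _ ≤ ENNReal.ofReal s * (ENNReal.ofReal ((2 * θ) ^ 2)) ^ (1 / 2 : ℝ) := by gcongr
      _ = ENNReal.ofReal (s * (2 * θ)) := by
        rw [ENNReal.ofReal_rpow_of_pos (by positivity), ← Real.sqrt_eq_rpow,
          Real.sqrt_sq (by positivity), ENNReal.ofReal_mul hs0.le]
      _ ≤ ENNReal.ofReal (δ * w) := by
        apply ENNReal.ofReal_le_ofReal
        nlinarith
      _ = _ := by rw [ENNReal.ofReal_mul hδ0.le, hWw]
end
end

section
/- (Conformal invariance of the Weingarten form.) Let U ⊆ ℝ² be open, Φ : U → S³ ⊂ ℝ⁴ a smooth conformal immersion into S³ with conformal factor e^λ, Gauss map n and trace-free Weingarten coefficients I⁰₁₁, I⁰₁₂. Let a ∈ ℝ⁴ with |a| < 1 and set Φ̃ := Ψ_a ∘ Φ and μ := μ_a ∘ Φ. Then Φ̃ is again a smooth conformal immersion into S³ with conformal factor e^{λ+μ}, and its trace-free Weingarten coefficients Ĩ⁰₁₁, Ĩ⁰₁₂ (computed from Φ̃ and its Gauss map ñ) satisfy Ĩ⁰₁₁ = e^{μ} I⁰₁₁ and Ĩ⁰₁₂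 = e^{μ} I⁰₁₂ at every point of U. -/
noncomputable section

open Real MeasureTheory
open scoped ENNReal RealInnerProductSpace

/-- Euclidean `ℝ⁴`. -/
abbrev RR4 := EuclideanSpace ℝ (Fin 4)

/-- Partial derivative in the `x₁` direction of an `ℝ⁴`-valued map on `ℝ²`. -/
def d1 (f : RR2 → RR4) (x : RR2) : RR4 := fderiv ℝ f x (1, 0)
/-- Partial derivative in the `x₂` direction of an `ℝ⁴`-valued map on `ℝ²`. -/
def d2 (f : RR2 → RR4) (x : RR2) : RR4 := fderiv ℝ f x (0, 1)
/-- Determinant of four vectors of `ℝ⁴`. -/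
def det4 (a b c d : RR4) : ℝ :=
  Matrix.det (Matrix.of ![(fun i => a i), (fun i => b i), (fun i => c i), (fun i => d i)])

/-- `Φ : U → S³ ⊂ ℝ⁴` is a smooth conformal immersion into `S³` with conformal factor
`e^lam` and (positively oriented) Gauss map `n`. -/
structure IsConformalImmersionS3 (U : Set RR2) (Φ : RR2 → RR4) (lam : RR2 → ℝ)
    (n : RR2 → RR4) : Prop where
  smooth_Phi : ContDiffOn ℝ (⊤ : ℕ∞) Φ U
  smooth_lam : ContDiffOn ℝ (⊤ : ℕ∞) lam U
  smooth_n : ContDiffOn ℝ (⊤ : ℕ∞) n U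
  mem_sphere : ∀ x ∈ U, ‖Φ x‖ = 1
  conf_orth : ∀ x ∈ U, ⟪d1 Φ x, d2 Φ x⟫ = 0
  conf_norm1 : ∀ x ∈ U, ‖d1 Φ x‖ = exp (lam x)
  conf_norm2 : ∀ x ∈ U, ‖d2 Φ x‖ = exp (lam x)
  n_norm : ∀ x ∈ U, ‖n x‖ = 1
  n_orth_Phi : ∀ x ∈ U, ⟪n x, Φ x⟫ = 0
  n_orth_d1 : ∀ x ∈ U, ⟪n x, d1 Φ x⟫ = 0
  n_orth_d2 : ∀ x ∈ U, ⟪n x, d2 Φ x⟫ = 0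
  oriented : ∀ x ∈ U, 0 < det4 (Φ x) (d1 Φ x) (d2 Φ x) (n x)

/-- Second fundamental form coefficient `I₁₁ = n·∂²_{x₁x₁}Φ`. -/
def I11 (Φ n : RR2 → RR4) (x : RR2) : ℝ := ⟪n x, d1 (d1 Φ) x⟫
/-- Second fundamental form coefficient `I₁₂ = n·∂²_{x₁x₂}Φ`. -/
def I12 (Φ n : RR2 → RR4) (x : RR2) : ℝ := ⟪n x, d2 (d1 Φ) x⟫
/-- Second fundamental form coefficient `I₂₂ = n·∂²_{x₂x₂}Φ`. -/
def I22 (Φ n : RR2 → RR4) (x : RR2) : ℝ := ⟪n x, d2 (d2 Φ) x⟫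

/-- Mean curvature `H = (1/2) e^{-2λ} (I₁₁ + I₂₂)`. -/
def meanCurv (Φ : RR2 → RR4) (lam : RR2 → ℝ) (n : RR2 → RR4) (x : RR2) : ℝ :=
  (1 / 2) * exp (-(2 * lam x)) * (I11 Φ n x + I22 Φ n x)

/-- Trace-free Weingarten coefficient `I⁰₁₁ = (I₁₁ - I₂₂)/2`. -/
def I011 (Φ n : RR2 → RR4) (x : RR2) : ℝ := (I11 Φ n x - I22 Φ n x) / 2
/-- Trace-free Weingarten coefficient `I⁰₁₂ = I₁₂`. -/
def I012 (Φ n : RR2 → RR4) (x : RR2) : ℝ := I12 Φ n x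

/-- The Möbius transformation `Ψ_a(y) = (1-|a|²)(y-a)/|y-a|² - a` of the sphere `S³`. -/
def moebius (a y : RR4) : RR4 := (1 - ‖a‖ ^ 2) • (‖y - a‖ ^ 2)⁻¹ • (y - a) - a

/-- The conformal factor `e^{μ_a(y)} = (1-|a|²)/(1+|a|²-2a·y)` of `Ψ_a` on `S³`. -/
def confFactor (a y : RR4) : ℝ := (1 - ‖a‖ ^ 2) / (1 + ‖a‖ ^ 2 - 2 * ⟪a, y⟫)

/-- Reflection of `v` across the hyperplane orthogonal to `w`. -/
def reflW (w v : RR4) : RR4 := v - (2 * ⟪w, v⟫ * (‖w‖ ^ 2)⁻¹) • w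

lemma inner_reflW (w v u : RR4) (hw : w ≠ 0) : ⟪reflW w v, reflW w u⟫ = ⟪v, u⟫ := by
  have hr : ‖w‖ ^ 2 ≠ 0 := by simpa using hw
  have hww : ⟪w, w⟫ = ‖w‖ ^ 2 := real_inner_self_eq_norm_sq w
  simp only [reflW, inner_sub_left, inner_sub_right, inner_smul_left, inner_smul_right, hww,
    real_inner_comm w v, conj_trivial]
  field_simp
  ring

lemma norm_reflW (w v : RR4) (hw : w ≠ 0) : ‖reflW w v‖ = ‖v‖ := by
  have h1 := inner_reflW w v v hw
  rw [real_inner_self_eq_norm_sq, real_inner_self_eq_norm_sq] at h1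
  exact (sq_eq_sq₀ (norm_nonneg _) (norm_nonneg _)).1 h1

lemma det4_smul (p q r t : ℝ) (a b c d : RR4) :
    det4 (p • a) (q • b) (r • c) (t • d) = p * q * r * t * det4 a b c d := by
  simp [det4, Matrix.det_succ_row_zero, Fin.sum_univ_succ, Fin.succAbove]
  ring

lemma det4_reflW (w a b c d : RR4) (hw : w ≠ 0) :
    det4 (reflW w a) (reflW w b) (reflW w c) (reflW w d) = - det4 a b c d := by
  have hr : ‖w‖ ^ 2 ≠ 0 := by simpa using hw
  have key : ∀ v : RR4, ∀ i, reflW w v i = v i - 2 * (‖w‖ ^ 2)⁻¹ * (∑ k, v k * w k) * w i := by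
    intro v i
    have : ⟪w, v⟫ = ∑ k, v k * w k := by simp [PiLp.inner_apply]
    simp only [reflW, this, PiLp.sub_apply, PiLp.smul_apply, smul_eq_mul]
    ring
  have hM : (Matrix.of ![(fun i => reflW w a i), (fun i => reflW w b i), (fun i => reflW w c i),
      (fun i => reflW w d i)] : Matrix (Fin 4) (Fin 4) ℝ)
      = Matrix.of ![(fun i => a i), (fun i => b i), (fun i => c i), (fun i => d i)]
        * (1 + Matrix.vecMulVec (fun i => -(2 * (‖w‖ ^ 2)⁻¹) * w i) (fun i => w i)) := by
    rw [Matrix.mul_add, Matrix.mul_one]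
    ext i j
    fin_cases i <;>
    · rw [Matrix.add_apply, Matrix.mul_apply]
      simp [key, Matrix.vecMulVec_apply, Fin.sum_univ_succ]
      ring
  have hd : (1 + Matrix.vecMulVec (fun i => -(2 * (‖w‖ ^ 2)⁻¹) * w i) (fun i => w i) :
      Matrix (Fin 4) (Fin 4) ℝ).det = -1 := by
    rw [Matrix.vecMulVec_eq Unit, Matrix.det_one_add_replicateCol_mul_replicateRow]
    have : ‖w‖ ^ 2 = ∑ k, w k * w k := by
      rw [EuclideanSpace.real_norm_sq_eq]
      exact Finset.sum_congr rfl fun k _ => by ring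
    have h2 : (fun i => w i) ⬝ᵥ (fun i => -(2 * (‖w‖ ^ 2)⁻¹) * w i)
        = -(2 * (‖w‖ ^ 2)⁻¹) * ∑ k, w k * w k := by
      rw [dotProduct, Finset.mul_sum]
      exact Finset.sum_congr rfl fun k _ => by ring
    rw [h2, ← this]
    field_simp
    norm_num
  unfold det4
  rw [hM, Matrix.det_mul, hd]
  ring

lemma eq_of_orth (u v w n m : RR4) (hn : ‖n‖ = 1) (hm : ‖m‖ = 1)
    (nu : ⟪n, u⟫ = 0) (nv : ⟪n, v⟫ = 0) (nw : ⟪n, w⟫ = 0)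
    (mu : ⟪m, u⟫ = 0) (mv : ⟪m, v⟫ = 0) (mw : ⟪m, w⟫ = 0)
    (dn : 0 < det4 u v w n) (dm : 0 < det4 u v w m) : m = n := by
  set t := ⟪m, n⟫ with ht
  have hz : m - t • n = 0 := by
    have hh : ∀ z : RR4, ⟪m - t • n, z⟫ = 0 → (∑ k, z k * (m - t • n) k) = 0 := by
      intro z hz
      rw [← hz]; simp [PiLp.inner_apply]
    have h1 := hh u (by simp [inner_sub_left, inner_smul_left, nu, mu])
    have h2 := hh v (by simp [inner_sub_left, inner_smul_left, nv, mv])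
    have h3 := hh w (by simp [inner_sub_left, inner_smul_left, nw, mw])
    have h4 := hh n (by
      simp [inner_sub_left, inner_smul_left, hn, ← ht])
    have := Matrix.eq_zero_of_mulVec_eq_zero (M := Matrix.of ![(fun i => u i), (fun i => v i),
      (fun i => w i), (fun i => n i)]) (v := fun k => (m - t • n) k) dn.ne' (by
        ext i
        fin_cases i
        · exact h1
        · exact h2
        · exact h3
        · exact h4)
    ext k
    exact congrFun this k
  have hmt : m = t • n := sub_eq_zero.1 hz
  have hd : det4 u v w m = t * det4 u v w n := by
    have := det4_smul 1 1 1 t u v w n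
    simpa [← hmt] using this
  have htpos : 0 < t := by
    rw [hd] at dm
    exact (pos_iff_pos_of_mul_pos dm).2 dn
  have : ‖m‖ = |t| * ‖n‖ := by conv_lhs => rw [hmt, norm_smul, Real.norm_eq_abs]
  rw [hm, hn, abs_of_pos htpos, mul_one] at this
  rw [hmt, ← this, one_smul]

lemma hasFDerivAt_moebius (a : RR4) (f : RR2 → RR4) (f' : RR2 →L[ℝ] RR4) (x : RR2)
    (hf : HasFDerivAt f f' x) (hx : f x - a ≠ 0) :
    ∃ L : RR2 →L[ℝ] RR4, HasFDerivAt (fun y => moebius a (f y)) L x ∧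
      ∀ e, L e = ((1 - ‖a‖ ^ 2) * (‖f x - a‖ ^ 2)⁻¹) • reflW (f x - a) (f' e) := by
  have hr : ‖f x - a‖ ^ 2 ≠ 0 := by simpa using hx
  have hw : HasFDerivAt (fun y => f y - a) f' x := hf.sub_const a
  have h2 := (hasDerivAt_inv hr).comp_hasFDerivAt x hw.norm_sq
  have h3 := ((h2.smul hw).const_smul (1 - ‖a‖ ^ 2)).sub_const a
  refine ⟨_, h3, fun e => ?_⟩
  simp only [Function.comp]
  generalize f x - a = w at *
  simp [reflW]
  module

lemma hasFDerivAt_refl (a N : RR4) (f g : RR2 → RR4) (f' g' : RR2 →L[ℝ] RR4) (x : RR2)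
    (hf : HasFDerivAt f f' x) (hg : HasFDerivAt g g' x) (hx : f x - a ≠ 0) (C : ℝ)
    (hNg : ⟪N, g x⟫ = 0) :
    ∃ L : RR2 →L[ℝ] RR4, HasFDerivAt
        (fun y => (C * (‖f y - a‖ ^ 2)⁻¹) • reflW (f y - a) (g y)) L x ∧
      ∀ e, ⟪N, f' e⟫ = 0 → ⟪reflW (f x - a) N, L e⟫ = C * (‖f x - a‖ ^ 2)⁻¹ * ⟪N, g' e⟫
        + 2 * C * ⟪f x - a, N⟫ * ((‖f x - a‖ ^ 2)⁻¹) ^ 2 * ⟪f' e, g x⟫ := by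
  have hr : ‖f x - a‖ ^ 2 ≠ 0 := by simpa using hx
  have hw : HasFDerivAt (fun y => f y - a) f' x := hf.sub_const a
  have h2 := (hasDerivAt_inv hr).comp_hasFDerivAt x hw.norm_sq
  have hin := hw.inner ℝ hg
  have h3 := (h2.const_mul C).smul (hg.sub (((hin.const_mul 2).mul h2).smul hw))
  refine ⟨_, h3, fun e he => ?_⟩
  have hww : ⟪f x - a, f x - a⟫ = ‖f x - a‖ ^ 2 := real_inner_self_eq_norm_sq _
  simp only [reflW, Function.comp, _root_.add_apply, _root_.sub_apply,
    _root_.smul_apply, ContinuousLinearMap.smulRight_apply,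
    ContinuousLinearMap.comp_apply, ContinuousLinearMap.prod_apply, fderivInnerCLM_apply,
    innerSL_apply_apply, Pi.sub_apply, Pi.mul_apply, Pi.smul_apply', Pi.smul_apply]
  generalize f x - a = w at *
  simp only [inner_sub_left, inner_sub_right, inner_add_right, inner_smul_left, inner_smul_right,
    conj_trivial, smul_eq_mul, nsmul_eq_mul, hww, hNg, he, real_inner_comm w N]
  generalize ‖w‖ ^ 2 = r at *
  field_simp
  push_cast
  ring

/-- **conformal invariance of the Weingarten form.** If `Φ : U → S³` is a
smooth conformal immersion with conformal factor `e^λ` and Gauss map `n`, and `|a| < 1`,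
then `Ψ_a ∘ Φ` is a smooth conformal immersion with conformal factor `e^{λ+μ}` where
`e^μ = confFactor a (Φ ·)`, and its trace-free Weingarten coefficients satisfy
`Ĩ⁰₁₁ = e^μ I⁰₁₁` and `Ĩ⁰₁₂ = e^μ I⁰₁₂` on `U`. -/
theorem weingarten_conformal_invariance
    (U : Set RR2) (hU : IsOpen U)
    (Φ : RR2 → RR4) (lam : RR2 → ℝ) (n : RR2 → RR4)
    (h : IsConformalImmersionS3 U Φ lam n)
    (a : RR4) (ha : ‖a‖ < 1) :
    (∃ nt : RR2 → RR4,
      IsConformalImmersionS3 U (fun x => moebius a (Φ x))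
        (fun x => lam x + Real.log (confFactor a (Φ x))) nt) ∧
    ∀ nt : RR2 → RR4,
      IsConformalImmersionS3 U (fun x => moebius a (Φ x))
        (fun x => lam x + Real.log (confFactor a (Φ x))) nt →
      ∀ x ∈ U,
        I011 (fun y => moebius a (Φ y)) nt x = confFactor a (Φ x) * I011 Φ n x ∧
        I012 (fun y => moebius a (Φ y)) nt x = confFactor a (Φ x) * I012 Φ n x := by
  have hne : ∀ x ∈ U, Φ x - a ≠ 0 := by
    intro x hx h0
    have := h.mem_sphere x hx
    rw [sub_eq_zero.1 h0] at this
    linarith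
  have hc : 0 < 1 - ‖a‖ ^ 2 := by nlinarith [norm_nonneg a]
  have hrr : ∀ x ∈ U, 1 + ‖a‖ ^ 2 - 2 * ⟪a, Φ x⟫ = ‖Φ x - a‖ ^ 2 := by
    intro x hx
    rw [norm_sub_sq_real, h.mem_sphere x hx, real_inner_comm]
    ring
  have hrp : ∀ x ∈ U, 0 < ‖Φ x - a‖ ^ 2 := by
    intro x hx
    have := norm_pos_iff.2 (hne x hx)
    positivity
  have hcf : ∀ x ∈ U, confFactor a (Φ x) = (1 - ‖a‖ ^ 2) * (‖Φ x - a‖ ^ 2)⁻¹ := by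
    intro x hx
    rw [confFactor, hrr x hx, div_eq_mul_inv]
  have hcp : ∀ x ∈ U, 0 < confFactor a (Φ x) := by
    intro x hx
    rw [hcf x hx]
    exact mul_pos hc (inv_pos.2 (hrp x hx))
  have hsm : ∀ x ∈ U, ContDiffAt ℝ (⊤ : ℕ∞) Φ x := fun x hx =>
    h.smooth_Phi.contDiffAt (hU.mem_nhds hx)
  have hF : ∀ x ∈ U, HasFDerivAt Φ (fderiv ℝ Φ x) x := fun x hx =>
    ((hsm x hx).differentiableAt (by simp)).hasFDerivAt
  have hG : ∀ x ∈ U, ∀ e : RR2, DifferentiableAt ℝ (fun y => fderiv ℝ Φ y e) x := by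
    intro x hx e
    have : ContDiffAt ℝ 1 (fderiv ℝ Φ) x := (hsm x hx).fderiv_right (by norm_cast)
    exact (this.differentiableAt (by simp)).clm_apply (differentiableAt_const e)
  have hD : ∀ x ∈ U, ∀ e : RR2, fderiv ℝ (fun y => moebius a (Φ y)) x e
      = ((1 - ‖a‖ ^ 2) * (‖Φ x - a‖ ^ 2)⁻¹) • reflW (Φ x - a) (fderiv ℝ Φ x e) := by
    intro x hx e
    obtain ⟨L, hL, hLe⟩ := hasFDerivAt_moebius a Φ _ x (hF x hx) (hne x hx)
    rw [hL.fderiv, hLe]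
  have hM : ∀ x ∈ U, moebius a (Φ x) = (-1 : ℝ) • reflW (Φ x - a) (Φ x) := by
    intro x hx
    have h1 : 2 * ⟪Φ x - a, Φ x⟫ = ‖Φ x - a‖ ^ 2 + (1 - ‖a‖ ^ 2) := by
      rw [← hrr x hx, inner_sub_left, real_inner_self_eq_norm_sq, h.mem_sphere x hx]
      ring
    have h2 := (hrp x hx).ne'
    rw [moebius, reflW, h1, add_mul, mul_inv_cancel₀ h2]
    module
  have hD1 : ∀ x ∈ U, d1 (fun y => moebius a (Φ y)) x
      = confFactor a (Φ x) • reflW (Φ x - a) (d1 Φ x) := by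
    intro x hx
    rw [hcf x hx]; exact hD x hx _
  have hD2 : ∀ x ∈ U, d2 (fun y => moebius a (Φ y)) x
      = confFactor a (Φ x) • reflW (Φ x - a) (d2 Φ x) := by
    intro x hx
    rw [hcf x hx]; exact hD x hx _
  have hw_smooth : ContDiffOn ℝ (⊤ : ℕ∞) (fun x => Φ x - a) U := h.smooth_Phi.sub contDiffOn_const
  have hi_smooth : ContDiffOn ℝ (⊤ : ℕ∞) (fun x => (‖Φ x - a‖ ^ 2)⁻¹) U :=
    (hw_smooth.norm_sq ℝ).inv fun x hx => (hrp x hx).ne'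
  have hE : IsConformalImmersionS3 U (fun x => moebius a (Φ x))
        (fun x => lam x + Real.log (confFactor a (Φ x))) (fun x => reflW (Φ x - a) (n x)) := by
    refine ⟨?_, ?_, ?_, ?_, ?_, ?_, ?_, ?_, ?_, ?_, ?_, ?_⟩
    · exact ((contDiffOn_const (c := 1 - ‖a‖ ^ 2)).smul (hi_smooth.smul hw_smooth)).sub contDiffOn_const
    · refine h.smooth_lam.add (ContDiffOn.log ?_ fun x hx => (hcp x hx).ne')
      exact (contDiffOn_const.mul hi_smooth).congr hcf
    · exact h.smooth_n.sub (((contDiffOn_const.mul (hw_smooth.inner ℝ h.smooth_n)).mul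
        hi_smooth).smul hw_smooth)
    · intro x hx
      simp [hM x hx, norm_reflW _ _ (hne x hx), h.mem_sphere x hx]
    · intro x hx
      rw [hD1 x hx, hD2 x hx, inner_smul_left, inner_smul_right, inner_reflW _ _ _ (hne x hx),
        h.conf_orth x hx]
      simp
    · intro x hx
      rw [hD1 x hx, norm_smul, norm_reflW _ _ (hne x hx), h.conf_norm1 x hx, Real.exp_add,
        Real.exp_log (hcp x hx), Real.norm_eq_abs, abs_of_pos (hcp x hx), mul_comm]
    · intro x hx
      rw [hD2 x hx, norm_smul, norm_reflW _ _ (hne x hx), h.conf_norm2 x hx, Real.exp_add,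
        Real.exp_log (hcp x hx), Real.norm_eq_abs, abs_of_pos (hcp x hx), mul_comm]
    · intro x hx
      rw [norm_reflW _ _ (hne x hx), h.n_norm x hx]
    · intro x hx
      simp only [hM x hx]
      rw [inner_smul_right, inner_reflW _ _ _ (hne x hx), h.n_orth_Phi x hx, mul_zero]
    · intro x hx
      rw [hD1 x hx, inner_smul_right, inner_reflW _ _ _ (hne x hx), h.n_orth_d1 x hx, mul_zero]
    · intro x hx
      rw [hD2 x hx, inner_smul_right, inner_reflW _ _ _ (hne x hx), h.n_orth_d2 x hx, mul_zero]
    · intro x hx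
      have h1 := det4_smul (-1) (confFactor a (Φ x)) (confFactor a (Φ x)) 1
        (reflW (Φ x - a) (Φ x)) (reflW (Φ x - a) (d1 Φ x)) (reflW (Φ x - a) (d2 Φ x))
        (reflW (Φ x - a) (n x))
      rw [one_smul, det4_reflW _ _ _ _ _ (hne x hx)] at h1
      rw [hD1 x hx, hD2 x hx, hM x hx, h1]
      have := mul_pos (mul_pos (hcp x hx) (hcp x hx)) (h.oriented x hx)
      linarith
  refine ⟨⟨_, hE⟩, fun nt hnt x hx => ?_⟩
  have hn : nt x = reflW (Φ x - a) (n x) :=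
    eq_of_orth _ _ _ _ _ (hE.n_norm x hx) (hnt.n_norm x hx) (hE.n_orth_Phi x hx)
      (hE.n_orth_d1 x hx) (hE.n_orth_d2 x hx) (hnt.n_orth_Phi x hx) (hnt.n_orth_d1 x hx)
      (hnt.n_orth_d2 x hx) (hE.oriented x hx) (hnt.oriented x hx)
  have hS : ∀ e e' : RR2, ⟪n x, fderiv ℝ Φ x e⟫ = 0 → ⟪n x, fderiv ℝ Φ x e'⟫ = 0 →
      ⟪nt x, fderiv ℝ (fun y => fderiv ℝ (fun z => moebius a (Φ z)) y e) x e'⟫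
        = confFactor a (Φ x) * ⟪n x, fderiv ℝ (fun y => fderiv ℝ Φ y e) x e'⟫
        + 2 * (1 - ‖a‖ ^ 2) * ⟪Φ x - a, n x⟫ * ((‖Φ x - a‖ ^ 2)⁻¹) ^ 2
          * ⟪fderiv ℝ Φ x e', fderiv ℝ Φ x e⟫ := by
    intro e e' he he'
    obtain ⟨L, hL, hLe⟩ := hasFDerivAt_refl a (n x) Φ (fun y => fderiv ℝ Φ y e) _ _ x (hF x hx)
      (hG x hx e).hasFDerivAt (hne x hx) (1 - ‖a‖ ^ 2) he
    have hev : (fun y => fderiv ℝ (fun z => moebius a (Φ z)) y e) =ᶠ[nhds x]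
        (fun y => ((1 - ‖a‖ ^ 2) * (‖Φ y - a‖ ^ 2)⁻¹) • reflW (Φ y - a) (fderiv ℝ Φ y e)) :=
      Filter.eventually_of_mem (hU.mem_nhds hx) fun y hy => hD y hy e
    rw [hev.fderiv_eq, hL.fderiv, hn, hLe e' he', hcf x hx]
  have o1 := h.n_orth_d1 x hx
  have o2 := h.n_orth_d2 x hx
  have e11 := hS (1, 0) (1, 0) o1 o1
  have e12 := hS (1, 0) (0, 1) o1 o2
  have e22 := hS (0, 1) (0, 1) o2 o2
  have i11 : ⟪fderiv ℝ Φ x (1, 0), fderiv ℝ Φ x (1, 0)⟫ = exp (lam x) ^ 2 := by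
    rw [real_inner_self_eq_norm_sq]; exact congrArg (· ^ 2) (h.conf_norm1 x hx)
  have i22 : ⟪fderiv ℝ Φ x (0, 1), fderiv ℝ Φ x (0, 1)⟫ = exp (lam x) ^ 2 := by
    rw [real_inner_self_eq_norm_sq]; exact congrArg (· ^ 2) (h.conf_norm2 x hx)
  have i12 : ⟪fderiv ℝ Φ x (0, 1), fderiv ℝ Φ x (1, 0)⟫ = 0 := by
    rw [real_inner_comm]; exact h.conf_orth x hx
  rw [i11] at e11
  rw [i22] at e22
  rw [i12, mul_zero, add_zero] at e12
  constructor
  · change (⟪nt x, fderiv ℝ (fun y => fderiv ℝ (fun z => moebius a (Φ z)) y (1, 0)) x (1, 0)⟫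
      - ⟪nt x, fderiv ℝ (fun y => fderiv ℝ (fun z => moebius a (Φ z)) y (0, 1)) x (0, 1)⟫) / 2
      = confFactor a (Φ x) * ((⟪n x, fderiv ℝ (fun y => fderiv ℝ Φ y (1, 0)) x (1, 0)⟫
      - ⟪n x, fderiv ℝ (fun y => fderiv ℝ Φ y (0, 1)) x (0, 1)⟫) / 2)
    rw [e11, e22]
    ring
  · exact e12
end
end

section
/- (First variation of the mean curvature.) Let U ⊆ ℝ² be open and Φ : (−1,1) × U → ℝ⁴ a smooth map with |Φ(t,x)| = 1 for all (t,x), such that each Φ_t := Φ(t,·) is an immersion (∂_{x₁}Φ_t and ∂_{x₂}Φ_t linearly independent everywhere), and suppose Φ₀ is a conformal immersion into S³ with conformal factor e^λ, Gauss map n, second fundamental form I_{ij} and mean curvature H. For each t let n_t be the unique unit vector field orthogonal to Φ_t, ∂_{x₁}Φ_t, ∂_{x₂}Φ_t with det(Φ_t, ∂_{x₁}Φ_t, ∂_{x₂}Φ_t, n_t) > 0, and let H_t := (1/2) Σ_{i,j} g_t^{ij} (n_t · ∂²_{x_i x_j}Φ_t), where (g_t^{ij}) is the inverse of (g_t)_{ij}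 := ∂_{x_i}Φ_t·∂_{x_j}Φ_t. Let w := ∂_tΦ(0,·) = σ₁ ∂_{x₁}Φ₀ + σ₂ ∂_{x₂}Φ₀ + v n. Then at every point of U: ∂_t H_t |_{t=0} = (1/2)[ e^{−2λ}(∂²_{x₁x₁}v + ∂²_{x₂x₂}v) + ( e^{−4λ}(I₁₁² + 2 I₁₂² + I₂₂²) + 2 ) v ] + σ₁ ∂_{x₁}H + σ₂ ∂_{x₂}H. -/
noncomputable section

open Real MeasureTheory
open scoped ENNReal RealInnerProductSpace

/-- The induced metric matrix `g_{ij} = ∂_{x_i}f · ∂_{x_j}f` of a map `f : ℝ² → ℝ⁴`. -/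
def gmat (f : RR2 → RR4) (x : RR2) : Matrix (Fin 2) (Fin 2) ℝ :=
  !![⟪d1 f x, d1 f x⟫, ⟪d1 f x, d2 f x⟫; ⟪d2 f x, d1 f x⟫, ⟪d2 f x, d2 f x⟫]

/-- The second fundamental form matrix `I_{ij} = nf·∂²_{x_i x_j}f` of a map `f` with
unit normal `nf`. -/
def Imat (f nf : RR2 → RR4) (x : RR2) : Matrix (Fin 2) (Fin 2) ℝ :=
  !![I11 f nf x, I12 f nf x; I12 f nf x, I22 f nf x]

/-- The mean curvature `H = (1/2) Σ g^{ij} I_{ij}` of a (not necessarily conformal)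
immersion `f` with unit normal `nf`. -/
def Hgen (f nf : RR2 → RR4) (x : RR2) : ℝ :=
  (1 / 2) * ∑ i : Fin 2, ∑ j : Fin 2, (gmat f x)⁻¹ i j * Imat f nf x i j

section helpers

variable {E F : Type*} [NormedAddCommGroup E] [NormedSpace ℝ E]
  [NormedAddCommGroup F] [NormedSpace ℝ F]

/-- Directional derivative. -/
def DD (e : E) (f : E → F) (x : E) : F := fderiv ℝ f x e

theorem d1_eq : d1 = DD ((1, 0) : RR2) := rfl
theorem d2_eq : d2 = DD ((0, 1) : RR2) := rfl
theorem d1s_eq : d1s = DD ((1, 0) : RR2) := rfl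
theorem d2s_eq : d2s = DD ((0, 1) : RR2) := rfl

/-- Smoothness on a set. -/
abbrev Sm (f : E → F) (S : Set E) : Prop := ContDiffOn ℝ ((⊤ : ℕ∞) : WithTop ℕ∞) f S

theorem Sm.DD {f : E → F} {S : Set E} (hS : IsOpen S) (hf : Sm f S) (e : E) :
    Sm (DD e f) S := by
  have h := hf.fderiv_of_isOpen (m := ((⊤ : ℕ∞) : WithTop ℕ∞)) hS (by simp)
  exact h.clm_apply contDiffOn_const

theorem Sm.da {f : E → F} {S : Set E} (hS : IsOpen S) (hf : Sm f S) {x : E} (hx : x ∈ S) :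
    DifferentiableAt ℝ f x :=
  (hf.contDiffAt (hS.mem_nhds hx)).differentiableAt (by simp)

theorem DD_congr {f g : E → F} {S : Set E} (hS : IsOpen S) (h : ∀ y ∈ S, f y = g y)
    (e : E) {x : E} (hx : x ∈ S) : DD e f x = DD e g x := by
  have : f =ᶠ[nhds x] g := Filter.eventuallyEq_of_mem (hS.mem_nhds hx) h
  unfold DD
  rw [this.fderiv_eq]

theorem DD_symm {f : E → F} {S : Set E} (hS : IsOpen S) (hf : Sm f S) (e e' : E)
    {x : E} (hx : x ∈ S) : DD e (DD e' f) x = DD e' (DD e f) x := by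
  have hc : ContDiffAt ℝ ((⊤ : ℕ∞) : WithTop ℕ∞) f x := hf.contDiffAt (hS.mem_nhds hx)
  have h1 : DifferentiableAt ℝ (fderiv ℝ f) x :=
    ((hf.fderiv_of_isOpen (m := ((⊤ : ℕ∞) : WithTop ℕ∞)) hS (by simp)).contDiffAt
      (hS.mem_nhds hx)).differentiableAt (by simp)
  have h2 : IsSymmSndFDerivAt ℝ f x := hc.isSymmSndFDerivAt (by
    simp only [minSmoothness_of_isRCLikeNormedField]
    exact WithTop.coe_le_coe.2 (le_top : (2 : ℕ∞) ≤ ⊤))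
  have key : ∀ a b : E, DD a (DD b f) x = fderiv ℝ (fderiv ℝ f) x a b := by
    intro a b
    have := (h1.hasFDerivAt.clm_apply (hasFDerivAt_const b x)).fderiv
    unfold DD
    rw [this]
    simp
  rw [key, key]
  exact h2 e e'

theorem DD_symm3 {f : E → F} {S : Set E} (hS : IsOpen S) (hf : Sm f S) (k e e' : E)
    {x : E} (hx : x ∈ S) : DD k (DD e' (DD e f)) x = DD e' (DD e (DD k f)) x := by
  rw [DD_symm hS (hf.DD hS e) k e' hx]
  exact DD_congr hS (fun y hy => DD_symm hS hf k e hy) e' hx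

theorem DD_add {f g : E → F} {x : E} (hf : DifferentiableAt ℝ f x)
    (hg : DifferentiableAt ℝ g x) (e : E) :
    DD e (fun y => f y + g y) x = DD e f x + DD e g x := by
  unfold DD
  rw [fderiv_fun_add hf hg]; rfl

theorem DD_smul {s : E → ℝ} {g : E → F} {x : E} (hf : DifferentiableAt ℝ s x)
    (hg : DifferentiableAt ℝ g x) (e : E) :
    DD e (fun y => s y • g y) x = s x • DD e g x + DD e s x • g x := by
  unfold DD
  rw [fderiv_fun_smul hf hg]; simp

theorem DD_smul2 {s : E → ℝ} {g : E → F} {S : Set E} (hS : IsOpen S)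
    (hs : Sm s S) (hg : Sm g S) (e : E) {x : E} (hx : x ∈ S) :
    DD e (DD e (fun y => s y • g y)) x
      = s x • DD e (DD e g) x + (2 * DD e s x) • DD e g x + DD e (DD e s) x • g x := by
  rw [DD_congr hS (g := fun y => s y • DD e g y + DD e s y • g y)
    (fun y hy => DD_smul (hs.da hS hy) (hg.da hS hy) e) e hx]
  have a1 := hs.da hS hx
  have a2 := hg.da hS hx
  have a3 := (hs.DD hS e).da hS hx
  have a4 := (hg.DD hS e).da hS hx
  rw [DD_add (a1.fun_smul a4) (a3.fun_smul a2), DD_smul a1 a4, DD_smul a3 a2]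
  module

theorem DD_inner {f g : E → RR4} {x : E} (hf : DifferentiableAt ℝ f x)
    (hg : DifferentiableAt ℝ g x) (e : E) :
    DD e (fun y => ⟪f y, g y⟫) x = ⟪f x, DD e g x⟫ + ⟪DD e f x, g x⟫ := by
  unfold DD
  rw [fderiv_inner_apply ℝ hf hg]

theorem inner_const {f g : E → RR4} {S : Set E} (hS : IsOpen S) (hf : Sm f S) (hg : Sm g S)
    {c : ℝ} (h : ∀ y ∈ S, ⟪f y, g y⟫ = c) (e : E) {x : E} (hx : x ∈ S) :
    ⟪f x, DD e g x⟫ + ⟪DD e f x, g x⟫ = 0 := by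
  rw [← DD_inner (hf.da hS hx) (hg.da hS hx), DD_congr hS h e hx]
  simp [DD]

/-- Combination of three terms. -/
theorem DD_W {s1 s2 s3 : E → ℝ} {A B C : E → F} {S : Set E} (hS : IsOpen S)
    (h1 : Sm s1 S) (h2 : Sm s2 S) (h3 : Sm s3 S) (hA : Sm A S) (hB : Sm B S) (hC : Sm C S)
    (e : E) {x : E} (hx : x ∈ S) :
    DD e (fun y => s1 y • A y + s2 y • B y + s3 y • C y) x
      = (s1 x • DD e A x + DD e s1 x • A x) + (s2 x • DD e B x + DD e s2 x • B x)
        + (s3 x • DD e C x + DD e s3 x • C x) := by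
  have a1 := h1.da hS hx
  have a2 := h2.da hS hx
  have a3 := h3.da hS hx
  have b1 := hA.da hS hx
  have b2 := hB.da hS hx
  have b3 := hC.da hS hx
  rw [DD_add ((a1.fun_smul b1).fun_add (a2.fun_smul b2)) (a3.fun_smul b3),
    DD_add (a1.fun_smul b1) (a2.fun_smul b2), DD_smul a1 b1, DD_smul a2 b2, DD_smul a3 b3]

theorem DD_W2 {s1 s2 s3 : E → ℝ} {A B C : E → F} {S : Set E} (hS : IsOpen S)
    (h1 : Sm s1 S) (h2 : Sm s2 S) (h3 : Sm s3 S) (hA : Sm A S) (hB : Sm B S) (hC : Sm C S)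
    (e : E) {x : E} (hx : x ∈ S) :
    DD e (DD e (fun y => s1 y • A y + s2 y • B y + s3 y • C y)) x
      = (s1 x • DD e (DD e A) x + (2 * DD e s1 x) • DD e A x + DD e (DD e s1) x • A x)
      + (s2 x • DD e (DD e B) x + (2 * DD e s2 x) • DD e B x + DD e (DD e s2) x • B x)
      + (s3 x • DD e (DD e C) x + (2 * DD e s3 x) • DD e C x + DD e (DD e s3) x • C x) := by
  have c1 : Sm (fun y => s1 y • A y) S := h1.smul hA
  have c2 : Sm (fun y => s2 y • B y) S := h2.smul hB
  have c3 : Sm (fun y => s3 y • C y) S := h3.smul hC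
  have c12 : Sm (fun y => s1 y • A y + s2 y • B y) S := c1.add c2
  rw [DD_congr hS (g := fun y => (DD e (fun y => s1 y • A y) y + DD e (fun y => s2 y • B y) y)
      + DD e (fun y => s3 y • C y) y)
    (fun y hy => by
      rw [DD_add (c12.da hS hy) (c3.da hS hy), DD_add (c1.da hS hy) (c2.da hS hy)]) e hx]
  have k1 := (c1.DD hS e).da hS hx
  have k2 := (c2.DD hS e).da hS hx
  have k3 := (c3.DD hS e).da hS hx
  rw [DD_add (k1.fun_add k2) k3, DD_add k1 k2, DD_smul2 hS h1 hA e hx, DD_smul2 hS h2 hB e hx,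
    DD_smul2 hS h3 hC e hx]

theorem slice_x {f : ℝ × E → F} {t : ℝ} {x : E} (h : DifferentiableAt ℝ f (t, x)) (e : E) :
    DD e (fun y => f (t, y)) x = DD ((0, e) : ℝ × E) f (t, x) := by
  have h2 : HasFDerivAt (fun y : E => (t, y)) (ContinuousLinearMap.inr ℝ ℝ E) x :=
    hasFDerivAt_prodMk_right t x
  have := (HasFDerivAt.comp x (g := f) h.hasFDerivAt h2).fderiv
  unfold DD
  change fderiv ℝ (f ∘ fun y => (t, y)) x e = _
  rw [this]; simp

theorem slice_t {f : ℝ × E → F} {t : ℝ} {x : E} (h : DifferentiableAt ℝ f (t, x)) :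
    HasDerivAt (fun s => f (s, x)) (DD ((1, 0) : ℝ × E) f (t, x)) t := by
  have h2 : HasDerivAt (fun s : ℝ => (s, x)) ((1 : ℝ), (0 : E)) t :=
    (hasDerivAt_id t).prodMk (hasDerivAt_const t x)
  exact HasFDerivAt.comp_hasDerivAt t (l := f) h.hasFDerivAt h2

theorem slice_xx {f : ℝ × E → F} {U : Set E} (hU : IsOpen U)
    (hf : Sm f (Set.Ioo (-1 : ℝ) 1 ×ˢ U)) {t : ℝ} (ht : t ∈ Set.Ioo (-1 : ℝ) 1)
    {x : E} (hx : x ∈ U) (e e' : E) :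
    DD e' (DD e (fun y => f (t, y))) x
      = DD ((0, e') : ℝ × E) (DD ((0, e) : ℝ × E) f) (t, x) := by
  have hS : IsOpen (Set.Ioo (-1 : ℝ) 1 ×ˢ U) := isOpen_Ioo.prod hU
  rw [DD_congr hU (fun y hy => slice_x (hf.da hS (x := (t, y)) ⟨ht, hy⟩) e) e' hx]
  exact slice_x ((hf.DD hS _).da hS (x := (t, x)) ⟨ht, hx⟩) e'

theorem time_x {f : ℝ × E → F} {U : Set E} (hU : IsOpen U)
    (hf : Sm f (Set.Ioo (-1 : ℝ) 1 ×ˢ U)) {w : E → F}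
    (hw : ∀ x ∈ U, deriv (fun t => f (t, x)) 0 = w x)
    {x : E} (hx : x ∈ U) (e : E) :
    HasDerivAt (fun t => DD e (fun y => f (t, y)) x) (DD e w x) 0 := by
  have hS : IsOpen (Set.Ioo (-1 : ℝ) 1 ×ˢ U) := isOpen_Ioo.prod hU
  have h0 : (0 : ℝ) ∈ Set.Ioo (-1 : ℝ) 1 := by norm_num
  have e1 : DD e w x = DD ((1, 0) : ℝ × E) (DD ((0, e) : ℝ × E) f) (0, x) := by
    rw [DD_symm hS hf _ _ (x := (0, x)) ⟨h0, hx⟩,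
      ← slice_x ((hf.DD hS _).da hS (x := (0, x)) ⟨h0, hx⟩)]
    refine DD_congr hU (fun y hy => ?_) e hx
    rw [← hw y hy]
    exact (slice_t (hf.da hS (x := (0, y)) ⟨h0, hy⟩)).deriv
  rw [e1]
  refine (slice_t ((hf.DD hS _).da hS (x := (0, x)) ⟨h0, hx⟩)).congr_of_eventuallyEq ?_
  filter_upwards [isOpen_Ioo.mem_nhds h0] with t ht
  exact slice_x (hf.da hS (x := (t, x)) ⟨ht, hx⟩) e

theorem time_xx {f : ℝ × E → F} {U : Set E} (hU : IsOpen U)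
    (hf : Sm f (Set.Ioo (-1 : ℝ) 1 ×ˢ U)) {w : E → F}
    (hw : ∀ x ∈ U, deriv (fun t => f (t, x)) 0 = w x)
    {x : E} (hx : x ∈ U) (e e' : E) :
    HasDerivAt (fun t => DD e' (DD e (fun y => f (t, y))) x) (DD e' (DD e w) x) 0 := by
  have hS : IsOpen (Set.Ioo (-1 : ℝ) 1 ×ˢ U) := isOpen_Ioo.prod hU
  have h0 : (0 : ℝ) ∈ Set.Ioo (-1 : ℝ) 1 := by norm_num
  have e1 : DD e' (DD e w) x
      = DD ((1, 0) : ℝ × E) (DD ((0, e') : ℝ × E) (DD ((0, e) : ℝ × E) f)) (0, x) := by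
    rw [DD_symm3 hS hf _ _ _ (x := (0, x)) ⟨h0, hx⟩,
      ← slice_xx hU (hf.DD hS _) h0 hx]
    refine DD_congr hU (fun z hz => ?_) e' hx
    refine DD_congr hU (fun y hy => ?_) e hz
    rw [← hw y hy]
    exact (slice_t (hf.da hS (x := (0, y)) ⟨h0, hy⟩)).deriv
  rw [e1]
  refine (slice_t (((hf.DD hS _).DD hS _).da hS (x := (0, x))
    ⟨h0, hx⟩)).congr_of_eventuallyEq ?_
  filter_upwards [isOpen_Ioo.mem_nhds h0] with t ht
  exact slice_xx hU hf ht hx e e'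


theorem eq_zero_of_orth {a b c d u : RR4} (h : det4 a b c d ≠ 0)
    (ha : ⟪u, a⟫ = 0) (hb : ⟪u, b⟫ = 0) (hc : ⟪u, c⟫ = 0) (hd : ⟪u, d⟫ = 0) : u = 0 := by
  have hz := Matrix.eq_zero_of_mulVec_eq_zero (v := fun i => u i) h (by
    simp only [PiLp.inner_apply, Fin.sum_univ_four, RCLike.inner_apply, conj_trivial] at ha hb hc hd
    ext i
    fin_cases i <;>
      simp [Matrix.mulVec, dotProduct, Fin.sum_univ_four] <;> linarith)
  ext i
  exact congrFun hz i

/-- Determinant in coordinates. -/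
theorem det4_eq (a b c d : RR4) : det4 a b c d =
    a 0 * (b 1 * (c 2 * d 3 - c 3 * d 2) - b 2 * (c 1 * d 3 - c 3 * d 1)
      + b 3 * (c 1 * d 2 - c 2 * d 1))
    - a 1 * (b 0 * (c 2 * d 3 - c 3 * d 2) - b 2 * (c 0 * d 3 - c 3 * d 0)
      + b 3 * (c 0 * d 2 - c 2 * d 0))
    + a 2 * (b 0 * (c 1 * d 3 - c 3 * d 1) - b 1 * (c 0 * d 3 - c 3 * d 0)
      + b 3 * (c 0 * d 1 - c 1 * d 0))
    - a 3 * (b 0 * (c 1 * d 2 - c 2 * d 1) - b 1 * (c 0 * d 2 - c 2 * d 0)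
      + b 2 * (c 0 * d 1 - c 1 * d 0)) := by
  unfold det4
  simp [Matrix.det_succ_row_zero, Fin.sum_univ_succ, Fin.succAbove]
  ring

/-- Triple cross product. -/
def cross3 (a b c : RR4) : RR4 :=
  WithLp.toLp 2 (fun i => det4 a b c (EuclideanSpace.single i 1))

theorem inner_cross3 (a b c d : RR4) : ⟪cross3 a b c, d⟫ = det4 a b c d := by
  simp only [PiLp.inner_apply, Fin.sum_univ_four, RCLike.inner_apply, conj_trivial, cross3, det4_eq]
  simp
  ring

theorem normal_eq {a b c N : RR4} (hN : ‖N‖ = 1) (ha : ⟪N, a⟫ = 0) (hb : ⟪N, b⟫ = 0)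
    (hc : ⟪N, c⟫ = 0) (h : 0 < det4 a b c N) :
    cross3 a b c ≠ 0 ∧ N = ‖cross3 a b c‖⁻¹ • cross3 a b c := by
  have hNN : ⟪N, N⟫ = 1 := by rw [real_inner_self_eq_norm_sq, hN]; norm_num
  have e : cross3 a b c - det4 a b c N • N = 0 := by
    apply eq_zero_of_orth h.ne'
    · rw [inner_sub_left, inner_cross3, inner_smul_left, ha, det4_eq]; simp; ring
    · rw [inner_sub_left, inner_cross3, inner_smul_left, hb, det4_eq]; simp; ring
    · rw [inner_sub_left, inner_cross3, inner_smul_left, hc, det4_eq]; simp; ring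
    · rw [inner_sub_left, inner_cross3, inner_smul_left, hNN]; simp
  have e2 : cross3 a b c = det4 a b c N • N := sub_eq_zero.mp e
  have e3 : ‖cross3 a b c‖ = det4 a b c N := by
    rw [e2, norm_smul, hN]; simp [abs_of_pos h]
  refine ⟨fun h0 => ?_, ?_⟩
  · rw [h0] at e3; simp at e3; linarith
  · rw [e3]
    conv_rhs => rw [e2]
    rw [smul_smul, inv_mul_cancel₀ h.ne', one_smul]

theorem cross3_diff {a b c : ℝ → RR4} {t : ℝ} (ha : DifferentiableAt ℝ a t)
    (hb : DifferentiableAt ℝ b t) (hc : DifferentiableAt ℝ c t) :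
    DifferentiableAt ℝ (fun s => cross3 (a s) (b s) (c s)) t := by
  rw [differentiableAt_euclidean] at ha hb hc ⊢
  intro i
  simp only [cross3, det4_eq]
  have a0 := ha 0
  have a1 := ha 1
  have a2 := ha 2
  have a3 := ha 3
  have b0 := hb 0
  have b1 := hb 1
  have b2 := hb 2
  have b3 := hb 3
  have c0 := hc 0
  have c1 := hc 1
  have c2 := hc 2
  have c3 := hc 3
  fun_prop

theorem Hgen_eq (f nf : RR2 → RR4) (x : RR2) : Hgen f nf x =
    (1 / 2) * ((⟪d2 f x, d2 f x⟫ * I11 f nf x - 2 * ⟪d1 f x, d2 f x⟫ * I12 f nf x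
      + ⟪d1 f x, d1 f x⟫ * I22 f nf x)
      / (⟪d1 f x, d1 f x⟫ * ⟪d2 f x, d2 f x⟫ - ⟪d1 f x, d2 f x⟫ ^ 2)) := by
  unfold Hgen
  rw [Matrix.inv_def, gmat, Imat, Matrix.adjugate_fin_two_of, Matrix.det_fin_two_of]
  simp only [Fin.sum_univ_two, Ring.inverse_eq_inv', real_inner_comm (d1 f x) (d2 f x)]
  simp
  ring

end helpers

/-- **first variation of the mean curvature.** For a smooth variation
`Φ : (-1,1) × U → S³` through immersions whose time-zero slice `Φ₀` is a conformal
immersion, with positively oriented unit normals `N t` and variation vector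
`∂_tΦ|_{t=0} = σ₁∂_{x₁}Φ₀ + σ₂∂_{x₂}Φ₀ + v n`, the mean curvatures
`H_t = (1/2)Σ g_t^{ij}(I_t)_{ij}` satisfy
`∂_tH_t|_{t=0} = (1/2)[e^{-2λ}Δv + (e^{-4λ}(I₁₁² + 2I₁₂² + I₂₂²) + 2)v] + σ₁∂_{x₁}H + σ₂∂_{x₂}H`. -/
theorem first_variation_mean_curvature
    (U : Set RR2) (hU : IsOpen U)
    (Φ : ℝ × RR2 → RR4)
    (hΦ : ContDiffOn ℝ (⊤ : ℕ∞) Φ (Set.Ioo (-1 : ℝ) 1 ×ˢ U))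
    (hsph : ∀ t ∈ Set.Ioo (-1 : ℝ) 1, ∀ x ∈ U, ‖Φ (t, x)‖ = 1)
    (himm : ∀ t ∈ Set.Ioo (-1 : ℝ) 1, ∀ x ∈ U,
      LinearIndependent ℝ ![d1 (fun y => Φ (t, y)) x, d2 (fun y => Φ (t, y)) x])
    (Φ₀ : RR2 → RR4) (hΦ₀ : ∀ x : RR2, Φ₀ x = Φ (0, x))
    (lam : RR2 → ℝ) (n : RR2 → RR4)
    (h0 : IsConformalImmersionS3 U Φ₀ lam n)
    (N : ℝ → RR2 → RR4)
    (hN_norm : ∀ t ∈ Set.Ioo (-1 : ℝ) 1, ∀ x ∈ U, ‖N t x‖ = 1)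
    (hN_Phi : ∀ t ∈ Set.Ioo (-1 : ℝ) 1, ∀ x ∈ U, ⟪N t x, Φ (t, x)⟫ = 0)
    (hN_d1 : ∀ t ∈ Set.Ioo (-1 : ℝ) 1, ∀ x ∈ U, ⟪N t x, d1 (fun y => Φ (t, y)) x⟫ = 0)
    (hN_d2 : ∀ t ∈ Set.Ioo (-1 : ℝ) 1, ∀ x ∈ U, ⟪N t x, d2 (fun y => Φ (t, y)) x⟫ = 0)
    (hN_orient : ∀ t ∈ Set.Ioo (-1 : ℝ) 1, ∀ x ∈ U,
      0 < det4 (Φ (t, x)) (d1 (fun y => Φ (t, y)) x) (d2 (fun y => Φ (t, y)) x) (N t x))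
    (σ₁ σ₂ v : RR2 → ℝ)
    (hσ₁ : ContDiffOn ℝ (⊤ : ℕ∞) σ₁ U) (hσ₂ : ContDiffOn ℝ (⊤ : ℕ∞) σ₂ U)
    (hv : ContDiffOn ℝ (⊤ : ℕ∞) v U)
    (hw : ∀ x ∈ U, deriv (fun t => Φ (t, x)) 0
      = σ₁ x • d1 Φ₀ x + σ₂ x • d2 Φ₀ x + v x • n x) :
    ∀ x ∈ U,
      deriv (fun t => Hgen (fun y => Φ (t, y)) (N t) x) 0
        = (1 / 2) * (exp (-(2 * lam x)) * (d1s (d1s v) x + d2s (d2s v) x)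
            + (exp (-(4 * lam x))
                * ((I11 Φ₀ n x) ^ 2 + 2 * (I12 Φ₀ n x) ^ 2 + (I22 Φ₀ n x) ^ 2) + 2) * v x)
          + σ₁ x * d1s (meanCurv Φ₀ lam n) x + σ₂ x * d2s (meanCurv Φ₀ lam n) x := by
  intro x hx
  have t0 : (0 : ℝ) ∈ Set.Ioo (-1 : ℝ) 1 := by norm_num
  have hS : IsOpen (Set.Ioo (-1 : ℝ) 1 ×ˢ U) := isOpen_Ioo.prod hU
  obtain ⟨sP, sL, sn, hPn, hco, hc1, hc2, hnn, hnP, hn1, hn2, hor⟩ := h0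
  have hslice : (fun y => Φ (0, y)) = Φ₀ := by ext1 y; rw [hΦ₀]
  -- the normal
  have hNn : N 0 x = n x := by
    have q1 := (normal_eq (hN_norm 0 t0 x hx) (hN_Phi 0 t0 x hx) (hN_d1 0 t0 x hx)
      (hN_d2 0 t0 x hx) (hN_orient 0 t0 x hx)).2
    have q2 := (normal_eq (hnn x hx) (hnP x hx) (hn1 x hx) (hn2 x hx) (hor x hx)).2
    rw [hslice, ← hΦ₀] at q1
    rw [q1]; exact q2.symm
  simp only [d1_eq, d2_eq, d1s_eq, d2s_eq] at *
  set e1 : RR2 := (1, 0) with he1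
  set e2 : RR2 := (0, 1) with he2
  have sP1 : Sm (DD e1 Φ₀) U := Sm.DD hU sP e1
  have sP2 : Sm (DD e2 Φ₀) U := Sm.DD hU sP e2
  set w : RR2 → RR4 := fun y => σ₁ y • DD e1 Φ₀ y + σ₂ y • DD e2 Φ₀ y + v y • n y with hwdef
  have hw' : ∀ y ∈ U, deriv (fun t => Φ (t, y)) 0 = w y := hw
  -- time derivatives
  have T0 : HasDerivAt (fun t => Φ (t, x)) (w x) 0 := by
    rw [← hw' x hx]
    exact (slice_t (Sm.da hS hΦ (x := (0, x)) ⟨t0, hx⟩)).differentiableAt.hasDerivAt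
  have T1 := time_x hU hΦ hw' hx e1
  have T2 := time_x hU hΦ hw' hx e2
  have T11 := time_xx hU hΦ hw' hx e1 e1
  have T12 := time_xx hU hΦ hw' hx e1 e2
  have T22 := time_xx hU hΦ hw' hx e2 e2
  have TN : DifferentiableAt ℝ (fun t => N t x) 0 := by
    have hd := cross3_diff T0.differentiableAt T1.differentiableAt T2.differentiableAt
    have hne := (normal_eq (hN_norm 0 t0 x hx) (hN_Phi 0 t0 x hx) (hN_d1 0 t0 x hx)
      (hN_d2 0 t0 x hx) (hN_orient 0 t0 x hx)).1
    have hd2 := ((hd.norm ℝ hne).fun_inv (norm_ne_zero_iff.2 hne)).fun_smul hd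
    refine hd2.congr_of_eventuallyEq ?_
    filter_upwards [isOpen_Ioo.mem_nhds t0] with t ht
    exact (normal_eq (hN_norm t ht x hx) (hN_Phi t ht x hx) (hN_d1 t ht x hx)
      (hN_d2 t ht x hx) (hN_orient t ht x hx)).2
  obtain ⟨N', TN⟩ : ∃ N', HasDerivAt (fun t => N t x) N' 0 := ⟨_, TN.hasDerivAt⟩
  have tconst : ∀ {f : ℝ → ℝ} {f' c : ℝ}, HasDerivAt f f' 0 →
      (∀ t ∈ Set.Ioo (-1 : ℝ) 1, f t = c) → f' = 0 := by
    intro f f' c hf hc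
    refine hf.unique ((hasDerivAt_const (0 : ℝ) c).congr_of_eventuallyEq ?_)
    filter_upwards [isOpen_Ioo.mem_nhds t0] with t ht using hc t ht
  have NN := tconst (TN.inner ℝ TN) (c := 1) (fun t ht => by
    rw [real_inner_self_eq_norm_sq, hN_norm t ht x hx]; norm_num)
  have NP := tconst (TN.inner ℝ T0) (fun t ht => hN_Phi t ht x hx)
  simp only [hNn, ← hΦ₀] at NN NP
  -- derivative of H
  have TH := ((((T2.inner ℝ T2).fun_mul (TN.inner ℝ T11)).fun_sub
    (((T1.inner ℝ T2).const_mul 2).fun_mul (TN.inner ℝ T12))).fun_add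
    ((T1.inner ℝ T1).fun_mul (TN.inner ℝ T22))).fun_div
    (((T1.inner ℝ T1).fun_mul (T2.inner ℝ T2)).fun_sub ((T1.inner ℝ T2).fun_pow 2))
  simp only [hNn, hslice] at TH
  -- spatial identities
  have hPP : ∀ y ∈ U, ⟪Φ₀ y, Φ₀ y⟫ = 1 := fun y hy => by
    rw [real_inner_self_eq_norm_sq, hPn y hy]; norm_num
  have hnn2 : ∀ y ∈ U, ⟪n y, n y⟫ = 1 := fun y hy => by
    rw [real_inner_self_eq_norm_sq, hnn y hy]; norm_num
  have h11 : ∀ y ∈ U, ⟪DD e1 Φ₀ y, DD e1 Φ₀ y⟫ = exp (2 * lam y) := fun y hy => by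
    rw [real_inner_self_eq_norm_sq, hc1 y hy, ← Real.exp_nat_mul]; norm_num
  have h22 : ∀ y ∈ U, ⟪DD e2 Φ₀ y, DD e2 Φ₀ y⟫ = exp (2 * lam y) := fun y hy => by
    rw [real_inner_self_eq_norm_sq, hc2 y hy, ← Real.exp_nat_mul]; norm_num
  have hPk : ∀ e, ∀ y ∈ U, ⟪Φ₀ y, DD e Φ₀ y⟫ = 0 := fun e y hy => by
    have := inner_const hU sP sP hPP e hy
    rw [real_inner_comm (Φ₀ y)] at this
    linarith [real_inner_comm (Φ₀ y) (DD e Φ₀ y)]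
  have hnk : ∀ e, ∀ y ∈ U, ⟪n y, DD e n y⟫ = 0 := fun e y hy => by
    have := inner_const hU sn sn hnn2 e hy
    linarith [real_inner_comm (n y) (DD e n y)]
  have hnkk : ∀ e, ⟪n x, DD e (DD e n) x⟫ + ⟪DD e n x, DD e n x⟫ = 0 := fun e =>
    inner_const hU sn (Sm.DD hU sn e) (hnk e) e hx
  have hPkk : ∀ e, ⟪Φ₀ x, DD e (DD e Φ₀) x⟫ + ⟪DD e Φ₀ x, DD e Φ₀ x⟫ = 0 := fun e =>
    inner_const hU sP (Sm.DD hU sP e) (hPk e) e hx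
  have hlamd : DifferentiableAt ℝ lam x := Sm.da hU sL hx
  have hexp : ∀ (c : ℝ) (e : RR2), DD e (fun y => exp (c * lam y)) x
      = c * DD e lam x * exp (c * lam x) := by
    intro c e
    have := ((hlamd.hasFDerivAt.const_mul c).exp).fderiv
    unfold DD
    rw [this]; simp; ring
  have h11k : ∀ e, ⟪DD e1 Φ₀ x, DD e (DD e1 Φ₀) x⟫ = DD e lam x * exp (2 * lam x) := fun e => by
    have := DD_congr hU h11 e hx
    rw [DD_inner (Sm.da hU sP1 hx) (Sm.da hU sP1 hx), hexp,
      real_inner_comm (DD e1 Φ₀ x)] at this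
    linarith
  have h22k : ∀ e, ⟪DD e2 Φ₀ x, DD e (DD e2 Φ₀) x⟫ = DD e lam x * exp (2 * lam x) := fun e => by
    have := DD_congr hU h22 e hx
    rw [DD_inner (Sm.da hU sP2 hx) (Sm.da hU sP2 hx), hexp,
      real_inner_comm (DD e2 Φ₀ x)] at this
    linarith
  have h12k : ∀ e, ⟪DD e1 Φ₀ x, DD e (DD e2 Φ₀) x⟫ + ⟪DD e (DD e1 Φ₀) x, DD e2 Φ₀ x⟫ = 0 :=
    fun e => inner_const hU sP1 sP2 hco e hx
  have hnP' : ∀ e, ⟪n x, DD e Φ₀ x⟫ + ⟪DD e n x, Φ₀ x⟫ = 0 :=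
    fun e => inner_const hU sn sP hnP e hx
  have hn1' : ∀ e, ⟪n x, DD e (DD e1 Φ₀) x⟫ + ⟪DD e n x, DD e1 Φ₀ x⟫ = 0 :=
    fun e => inner_const hU sn sP1 hn1 e hx
  have hn2' : ∀ e, ⟪n x, DD e (DD e2 Φ₀) x⟫ + ⟪DD e n x, DD e2 Φ₀ x⟫ = 0 :=
    fun e => inner_const hU sn sP2 hn2 e hx
  have s21 : DD e1 (DD e2 Φ₀) x = DD e2 (DD e1 Φ₀) x := DD_symm hU sP e1 e2 hx
  have H11 := h11 x hx
  have H22 := h22 x hx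
  have H12 := hco x hx
  have HnP := hnP x hx
  have Hn1 := hn1 x hx
  have Hn2 := hn2 x hx
  have HPP := hPP x hx
  have Hnn := hnn2 x hx
  have HP1 := hPk e1 x hx
  have HP2 := hPk e2 x hx
  have hdet := (hor x hx).ne'
  have hEpos : 0 < exp (2 * lam x) := Real.exp_pos _
  -- third derivatives and meanCurv
  have hmc : ∀ e, DD e (meanCurv Φ₀ lam n) x
      = (1 / 2) * exp (-2 * lam x) * (⟪n x, DD e1 (DD e1 (DD e Φ₀)) x⟫
          + ⟪n x, DD e2 (DD e2 (DD e Φ₀)) x⟫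
          + ⟪DD e n x, DD e1 (DD e1 Φ₀) x⟫ + ⟪DD e n x, DD e2 (DD e2 Φ₀) x⟫)
        - DD e lam x * exp (-2 * lam x) *
          (⟪n x, DD e1 (DD e1 Φ₀) x⟫ + ⟪n x, DD e2 (DD e2 Φ₀) x⟫) := by
    intro e
    have q1 := Sm.da hU sn hx
    have q2 := Sm.da hU (Sm.DD hU sP1 e1) hx
    have q3 := Sm.da hU (Sm.DD hU sP2 e2) hx
    have hf : meanCurv Φ₀ lam n = fun y => (exp (-2 * lam y)) • ((1 / 2 : ℝ) • 
        (⟪n y, DD e1 (DD e1 Φ₀) y⟫ + ⟪n y, DD e2 (DD e2 Φ₀) y⟫)) := by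
      ext y
      simp only [meanCurv, I11, I22, d1_eq, d2_eq, smul_eq_mul]
      rw [show -(2 * lam y) = -2 * lam y by ring]
      ring
    have dI := (q1.inner ℝ q2).fun_add (q1.inner ℝ q3)
    rw [hf, DD_smul (hlamd.const_mul (-2)).exp (dI.fun_const_smul (1 / 2 : ℝ)), hexp,
      DD_smul (differentiableAt_const _) dI, DD_add (q1.inner ℝ q2) (q1.inner ℝ q3),
      DD_inner q1 q2, DD_inner q1 q3, DD_symm3 hU sP e e1 e1 hx, DD_symm3 hU sP e e2 e2 hx]
    simp only [smul_eq_mul]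
    have : DD e (fun _ : RR2 => (1 / 2 : ℝ)) x = 0 := by simp [DD]
    rw [this]
    ring
  -- vector identities
  have lapl : DD e1 (DD e1 Φ₀) x + DD e2 (DD e2 Φ₀) x
      = (-2 * exp (2 * lam x)) • Φ₀ x
        + (⟪n x, DD e1 (DD e1 Φ₀) x⟫ + ⟪n x, DD e2 (DD e2 Φ₀) x⟫) • n x := by
    rw [← sub_eq_zero]
    have k1 := h11k e1
    have k2 := h11k e2
    have k3 := h22k e1
    have k4 := h22k e2
    have k5 := h12k e1
    have k6 := h12k e2
    have k7 := hPkk e1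
    have k8 := hPkk e2
    rw [s21] at k5 k3
    apply eq_zero_of_orth hdet <;>
      simp only [inner_sub_left, inner_add_left, inner_smul_left, conj_trivial, HPP, HnP, HP1, HP2,
        Hn1, Hn2, Hnn]
    · rw [real_inner_comm (Φ₀ x), real_inner_comm (Φ₀ x)]; linarith
    · rw [real_inner_comm (DD e1 Φ₀ x), real_inner_comm (DD e1 Φ₀ x)]
      rw [real_inner_comm (DD e2 Φ₀ x)] at k6; linarith
    · rw [real_inner_comm (DD e2 Φ₀ x) (DD e2 (DD e2 Φ₀) x)]; linarith
    · rw [real_inner_comm (n x), real_inner_comm (n x), real_inner_comm (n x) (Φ₀ x), HnP]; ring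
  have nk : ∀ e, DD e n x = (-((exp (2 * lam x))⁻¹ * ⟪n x, DD e (DD e1 Φ₀) x⟫)) • DD e1 Φ₀ x
      + (-((exp (2 * lam x))⁻¹ * ⟪n x, DD e (DD e2 Φ₀) x⟫)) • DD e2 Φ₀ x := by
    intro e
    rw [← sub_eq_zero]
    have H21 : ⟪DD e2 Φ₀ x, DD e1 Φ₀ x⟫ = 0 := by rw [real_inner_comm]; exact H12
    have k1 := hn1' e
    have k2 := hn2' e
    have k3 := hnk e x hx
    have k4 : ⟪n x, DD e Φ₀ x⟫ = 0 := by
      have : DD e Φ₀ x = e.1 • DD e1 Φ₀ x + e.2 • DD e2 Φ₀ x := by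
        unfold DD
        rw [← map_smul, ← map_smul, ← map_add]
        simp [he1, he2]
      rw [this, inner_add_right, inner_smul_right, inner_smul_right, Hn1, Hn2]; ring
    have k5 := hnP' e
    apply eq_zero_of_orth hdet <;>
      simp only [inner_sub_left, inner_add_left, inner_smul_left, conj_trivial, H11, H12, H22, H21]
    · rw [real_inner_comm (Φ₀ x) (DD e1 Φ₀ x), real_inner_comm (Φ₀ x) (DD e2 Φ₀ x), HP1, HP2]
      linarith
    · linear_combination k1 + ⟪n x, DD e (DD e1 Φ₀) x⟫ * inv_mul_cancel₀ hEpos.ne'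
    · linear_combination k2 + ⟪n x, DD e (DD e2 Φ₀) x⟫ * inv_mul_cancel₀ hEpos.ne'
    · rw [real_inner_comm (n x), real_inner_comm (n x) (DD e1 Φ₀ x),
        real_inner_comm (n x) (DD e2 Φ₀ x), k3, Hn1, Hn2]; ring
  have n1 := nk e1
  have n2 := nk e2
  rw [s21] at n1
  have hn11 := hnkk e1
  have hn22 := hnkk e2
  have H21 : ⟪DD e2 Φ₀ x, DD e1 Φ₀ x⟫ = 0 := by rw [real_inner_comm]; exact H12
  have H1n : ⟪DD e1 Φ₀ x, n x⟫ = 0 := by rw [real_inner_comm]; exact Hn1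
  have H2n : ⟪DD e2 Φ₀ x, n x⟫ = 0 := by rw [real_inner_comm]; exact Hn2
  have HPn : ⟪Φ₀ x, n x⟫ = 0 := by rw [real_inner_comm]; exact HnP
  have HPa : ⟪DD e1 Φ₀ x, Φ₀ x⟫ = 0 := by rw [real_inner_comm]; exact HP1
  have HPb : ⟪DD e2 Φ₀ x, Φ₀ x⟫ = 0 := by rw [real_inner_comm]; exact HP2
  -- normal derivative against Laplacian
  have nlap : ∀ e, ⟪DD e n x, DD e1 (DD e1 Φ₀) x⟫ + ⟪DD e n x, DD e2 (DD e2 Φ₀) x⟫ = 0 := by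
    intro e
    rw [← inner_add_right, lapl, nk e]
    simp only [inner_add_left, inner_add_right, inner_smul_left, inner_smul_right, conj_trivial,
      H1n, H2n, HPa, HPb]
    ring
  have hwx : w x = σ₁ x • DD e1 Φ₀ x + σ₂ x • DD e2 Φ₀ x + v x • n x := rfl
  have Nlap : ⟪N', DD e1 (DD e1 Φ₀) x⟫ + ⟪N', DD e2 (DD e2 Φ₀) x⟫
      = 2 * exp (2 * lam x) * v x := by
    have hN'n : ⟪N', n x⟫ = 0 := by
      rw [real_inner_comm N' (n x)] at NN; linarith
    have hN'P : ⟪N', Φ₀ x⟫ = - v x := by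
      rw [hwx] at NP
      simp only [inner_add_right, inner_smul_right, Hn1, Hn2, Hnn] at NP
      linarith
    rw [← inner_add_right, lapl]
    simp only [inner_add_right, inner_smul_right, hN'n, hN'P]
    ring
  have W1 : DD e1 w x = _ := DD_W hU hσ₁ hσ₂ hv sP1 sP2 sn e1 hx
  have W2 : DD e2 w x = _ := DD_W hU hσ₁ hσ₂ hv sP1 sP2 sn e2 hx
  have W11 : DD e1 (DD e1 w) x = _ := DD_W2 hU hσ₁ hσ₂ hv sP1 sP2 sn e1 hx
  have W22 : DD e2 (DD e2 w) x = _ := DD_W2 hU hσ₁ hσ₂ hv sP1 sP2 sn e2 hx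
  rw [s21] at W1 W11
  have k1 := h11k e1
  have k2 := h11k e2
  have k3 := h22k e1
  have k4 := h22k e2
  have k5 := h12k e1
  have k6 := h12k e2
  rw [s21] at k3 k5
  rw [real_inner_comm (DD e2 Φ₀ x)] at k5 k6
  have m1 := hmc e1
  have m2 := hmc e2
  have l1 := nlap e1
  have l2 := nlap e2
  have hexpm : exp (-2 * lam x) = (exp (2 * lam x))⁻¹ := by
    rw [← Real.exp_neg]; congr 1; ring
  have hexpm2 : exp (-(2 * lam x)) = (exp (2 * lam x))⁻¹ := by
    rw [← Real.exp_neg]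
  have hexpm4 : exp (-(4 * lam x)) = (exp (2 * lam x))⁻¹ ^ 2 := by
    rw [← Real.exp_neg, ← Real.exp_nat_mul]; congr 1; push_cast; ring
  have fin := (TH (by rw [H11, H22, H12]; simp)).const_mul (1 / 2 : ℝ)
  have hfun : (fun t => Hgen (fun y => Φ (t, y)) (N t) x) = _ :=
    funext fun t => Hgen_eq (fun y => Φ (t, y)) (N t) x
  rw [hfun]
  refine Eq.trans fin.deriv ?_
  rw [m1, m2, hexpm, hexpm2, hexpm4]
  simp only [I11, I12, I22, d1_eq, d2_eq, ← he1, ← he2]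
  -- scalar quantities
  set E := exp (2 * lam x) with hE
  set A := ⟪n x, DD e1 (DD e1 Φ₀) x⟫ with hA
  set B := ⟪n x, DD e2 (DD e1 Φ₀) x⟫ with hB
  set C := ⟪n x, DD e2 (DD e2 Φ₀) x⟫ with hC
  have g11 : ⟪DD e1 Φ₀ x, DD e1 w x⟫ = E * DD e1 σ₁ x
      + (σ₁ x * DD e1 lam x + σ₂ x * DD e2 lam x) * E - v x * A := by
    rw [W1, n1]
    simp only [inner_add_right, inner_smul_right, H11, H12, H1n, k1, k2]
    field_simp; ring
  have g22 : ⟪DD e2 Φ₀ x, DD e2 w x⟫ = E * DD e2 σ₂ x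
      + (σ₁ x * DD e1 lam x + σ₂ x * DD e2 lam x) * E - v x * C := by
    rw [W2, n2]
    simp only [inner_add_right, inner_smul_right, H22, H21, H2n, k3, k4]
    field_simp; ring
  have g12 : ⟪DD e1 Φ₀ x, DD e2 w x⟫ + ⟪DD e2 Φ₀ x, DD e1 w x⟫
      = E * (DD e2 σ₁ x + DD e1 σ₂ x) - 2 * v x * B := by
    have k6' : ⟪DD e1 Φ₀ x, DD e2 (DD e2 Φ₀) x⟫ = - ⟪DD e2 Φ₀ x, DD e2 (DD e1 Φ₀) x⟫ := by linarith
    have k5' : ⟪DD e2 Φ₀ x, DD e1 (DD e1 Φ₀) x⟫ = - ⟪DD e1 Φ₀ x, DD e2 (DD e1 Φ₀) x⟫ := by linarith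
    rw [W1, W2, n1, n2]
    simp only [inner_add_right, inner_smul_right, H11, H22, H21, H12, H1n, H2n, k6', k5', k2, k3]
    field_simp; ring
  have q11 : ⟪n x, DD e1 (DD e1 n) x⟫ = - E⁻¹ * (A ^ 2 + B ^ 2) := by
    rw [n1] at hn11
    simp only [inner_add_left, inner_add_right, inner_smul_left, inner_smul_right, conj_trivial,
      H11, H22, H21, H12] at hn11
    linear_combination hn11 - E⁻¹ * (A ^ 2 + B ^ 2) * inv_mul_cancel₀ hEpos.ne'
  have q22 : ⟪n x, DD e2 (DD e2 n) x⟫ = - E⁻¹ * (B ^ 2 + C ^ 2) := by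
    rw [n2] at hn22
    simp only [inner_add_left, inner_add_right, inner_smul_left, inner_smul_right, conj_trivial,
      H11, H22, H21, H12] at hn22
    linear_combination hn22 - E⁻¹ * (B ^ 2 + C ^ 2) * inv_mul_cancel₀ hEpos.ne'
  have z1 : ⟪n x, DD e1 n x⟫ = 0 := hnk e1 x hx
  have z2 : ⟪n x, DD e2 n x⟫ = 0 := hnk e2 x hx
  have p11 : ⟪n x, DD e1 (DD e1 w) x⟫ = σ₁ x * ⟪n x, DD e1 (DD e1 (DD e1 Φ₀)) x⟫
      + 2 * DD e1 σ₁ x * A + σ₂ x * ⟪n x, DD e1 (DD e1 (DD e2 Φ₀)) x⟫ + 2 * DD e1 σ₂ x * B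
      - v x * E⁻¹ * (A ^ 2 + B ^ 2) + DD e1 (DD e1 v) x := by
    rw [W11]
    simp only [inner_add_right, inner_smul_right, Hn1, Hn2, Hnn, z1, q11]
    ring
  have p22 : ⟪n x, DD e2 (DD e2 w) x⟫ = σ₁ x * ⟪n x, DD e2 (DD e2 (DD e1 Φ₀)) x⟫
      + 2 * DD e2 σ₁ x * B + σ₂ x * ⟪n x, DD e2 (DD e2 (DD e2 Φ₀)) x⟫ + 2 * DD e2 σ₂ x * C
      - v x * E⁻¹ * (B ^ 2 + C ^ 2) + DD e2 (DD e2 v) x := by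
    rw [W22]
    simp only [inner_add_right, inner_smul_right, Hn1, Hn2, Hnn, z2, q22]
    ring
  have y1 := eq_sub_of_add_eq l1
  have y2 := eq_sub_of_add_eq l2
  have y3 := eq_sub_of_add_eq Nlap
  have y4 := eq_sub_of_add_eq g12
  rw [real_inner_comm (DD e2 Φ₀ x) (DD e1 w x), real_inner_comm (DD e1 Φ₀ x) (DD e1 w x),
    real_inner_comm (DD e2 Φ₀ x) (DD e2 w x)]
  rw [H11, H22, H12, g11, g22, p11, p22, y1, y2, y3, y4]
  have hE0 : E ≠ 0 := hEpos.ne'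
  clear_value E A B C
  field_simp
  ring
end
end
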